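/- arXiv:2506.08824 — 3 statements merged into one kernel-verified Lean document; each statement's English description precedes it below -/
import Mathlib

section
/- Assume d_x ≥ 1 and D_x ≥ 1. Suppose ν ∈ ℕ is such that ker φ_{ν'} = 0 for every ν' < ν, and ker φ_ν is the principal ideal generated by a nonzero polynomial P ∈ K[μ_1,…,μ_r, y_0,…,y_ν] (this P is the minimal polynomial of the differential elimination ideal of the system x' = g(μ,x), y = f(μ,x)). Then for every monomial μ_1^{ℓ_1}···μ_r^{ℓ_r} y_0^{e_0}···y_ν^{e_ν} occurring in P one has ℓ_1 + ⋯ + ℓ_r + Σ_{i=0}^{ν} (d_μ + i·D_μ)·e_i ≤ Σ_{i=0}^{ν} (d_μ + i·D_μ)·Π_{j=0, j≠i}^{ν} (d_x + j·(D_x − 1)). -/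
open MvPolynomial

/-- Total degree of `p` with respect to the `μ`-variables (indexed by `Sum.inl`). -/
noncomputable def degMu {K : Type*} [CommSemiring K] {r n : ℕ}
    (p : MvPolynomial (Fin r ⊕ Fin n) K) : ℕ :=
  p.support.sup fun m => ∑ j : Fin r, m (Sum.inl j)

/-- Total degree of `p` with respect to the `x`-variables (indexed by `Sum.inr`). -/
noncomputable def degXv {K : Type*} [CommSemiring K] {r n : ℕ}
    (p : MvPolynomial (Fin r ⊕ Fin n) K) : ℕ :=
  p.support.sup fun m => ∑ i : Fin n, m (Sum.inr i)

/-- The `K`-algebra homomorphism `φ_ν : K[μ_1,…,μ_r, y_0,…,y_ν] → K[μ, x]`,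
sending `μ_j ↦ μ_j` and `y_k ↦ L^k(f)`. -/
noncomputable def liePhi {K : Type*} [Field K] [CharZero K] {r n : ℕ}
    (f : MvPolynomial (Fin r ⊕ Fin n) K)
    (L : Derivation ℚ (MvPolynomial (Fin r ⊕ Fin n) K) (MvPolynomial (Fin r ⊕ Fin n) K))
    (ν : ℕ) :
    MvPolynomial (Fin r ⊕ Fin (ν + 1)) K →ₐ[K] MvPolynomial (Fin r ⊕ Fin n) K :=
  aeval (Sum.elim (fun j => X (Sum.inl j)) (fun k : Fin (ν + 1) => (⇑L)^[(k : ℕ)] f))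

/-- The submodule of polynomials all of whose monomials have weight at most `d`. -/
noncomputable def weightLE {σ : Type*} (R : Type*) [CommSemiring R] (w : σ → ℕ) (d : ℕ) :
    Submodule R (MvPolynomial σ R) :=
  restrictSupport R {m | Finsupp.weight w m ≤ d}

section WeightLE

variable {σ τ R : Type*} [CommRing R] {w : σ → ℕ} {d e : ℕ}

theorem mem_weightLE {p : MvPolynomial σ R} :
    p ∈ weightLE R w d ↔ ∀ m ∈ p.support, Finsupp.weight w m ≤ d := by
  simp only [weightLE, restrictSupport]
  exact Iff.rfl

theorem monomial_mem_weightLE {m : σ →₀ ℕ} (h : Finsupp.weight w m ≤ d) (c : R) :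
    monomial m c ∈ weightLE R w d :=
  (monomial_mem_restrictSupport R).2 (Or.inl h)

theorem weightLE_mono (h : d ≤ e) : weightLE R w d ≤ weightLE R w e :=
  fun _ hp => mem_weightLE.2 fun m hm => (mem_weightLE.1 hp m hm).trans h

theorem C_mem_weightLE (c : R) : C c ∈ weightLE R w d :=
  monomial_mem_weightLE (by simp) c

theorem X_mem_weightLE {i : σ} (h : w i ≤ d) : (X i : MvPolynomial σ R) ∈ weightLE R w d :=
  monomial_mem_weightLE (by simpa [Finsupp.weight_single] using h) 1

theorem mul_mem_weightLE {p q : MvPolynomial σ R} (hp : p ∈ weightLE R w d)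
    (hq : q ∈ weightLE R w e) : p * q ∈ weightLE R w (d + e) := by
  classical
  refine mem_weightLE.2 fun m hm => ?_
  obtain ⟨a, ha, b, hb, rfl⟩ := Finset.mem_add.1 (support_mul p q hm)
  rw [map_add]
  exact add_le_add (mem_weightLE.1 hp a ha) (mem_weightLE.1 hq b hb)

theorem pow_mem_weightLE {p : MvPolynomial σ R} (hp : p ∈ weightLE R w d) (k : ℕ) :
    p ^ k ∈ weightLE R w (k * d) := by
  induction k with
  | zero => simpa using C_mem_weightLE (w := w) (d := 0) (1 : R)
  | succ k ih => rw [pow_succ, Nat.succ_mul]; exact mul_mem_weightLE ih hp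

theorem prod_mem_weightLE {ι : Type*} (s : Finset ι) {p : ι → MvPolynomial σ R} {d : ι → ℕ}
    (hp : ∀ i ∈ s, p i ∈ weightLE R w (d i)) : ∏ i ∈ s, p i ∈ weightLE R w (∑ i ∈ s, d i) := by
  classical
  induction s using Finset.induction_on with
  | empty => simpa using C_mem_weightLE (w := w) (d := 0) (1 : R)
  | insert a s ha ih =>
    rw [Finset.prod_insert ha, Finset.sum_insert ha]
    exact mul_mem_weightLE (hp a (by simp)) (ih fun i hi => hp i (by simp [hi]))

theorem rename_mem_weightLE {w : τ → ℕ} {f : σ → τ} {p : MvPolynomial σ R}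
    (hp : p ∈ weightLE R (w ∘ f) d) : rename f p ∈ weightLE R w d := by
  rw [p.as_sum, map_sum]
  refine Submodule.sum_mem _ fun m hm => ?_
  rw [rename_monomial]
  refine monomial_mem_weightLE ?_ _
  have := mem_weightLE.1 hp m hm
  rw [Finsupp.weight_apply] at this ⊢
  rwa [Finsupp.sum_mapDomain_index (by simp) (by intros; simp [add_mul])]

/-- The homomorphism scaling each variable by a power of an auxiliary variable. -/
noncomputable def scaleHom (R : Type*) [CommRing R] (w : σ → ℕ) :
    MvPolynomial σ R →ₐ[R] Polynomial (MvPolynomial σ R) :=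
  aeval fun i => Polynomial.C (X i) * Polynomial.X ^ w i

theorem scaleHom_monomial (m : σ →₀ ℕ) (c : R) :
    scaleHom R w (monomial m c) = Polynomial.monomial (Finsupp.weight w m) (monomial m c) := by
  rw [scaleHom, aeval_monomial, ← Polynomial.C_mul_X_pow_eq_monomial, Finsupp.weight_apply,
    monomial_eq, map_mul, mul_assoc]
  simp only [Finsupp.sum, Finsupp.prod, map_prod, ← Finset.prod_pow_eq_pow_sum,
    ← Finset.prod_mul_distrib, mul_pow, ← pow_mul, smul_eq_mul, map_pow, mul_comm]
  rfl

theorem coeff_coeff_scaleHom (p : MvPolynomial σ R) (m : σ →₀ ℕ) :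
    ((scaleHom R w p).coeff (Finsupp.weight w m)).coeff m = p.coeff m := by
  classical
  induction p using MvPolynomial.induction_on' with
  | monomial a c =>
    rw [scaleHom_monomial, Polynomial.coeff_monomial, coeff_monomial]
    by_cases h : a = m
    · simp [h]
    · by_cases h' : Finsupp.weight w a = Finsupp.weight w m <;> simp [h, h', coeff_monomial]
  | add p q hp hq => simp [hp, hq]

theorem mem_weightLE_iff_natDegree {p : MvPolynomial σ R} :
    p ∈ weightLE R w d ↔ (scaleHom R w p).natDegree ≤ d := by
  refine ⟨fun h => ?_, fun h => mem_weightLE.2 fun m hm => ?_⟩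
  · rw [p.as_sum, map_sum]
    refine Polynomial.natDegree_sum_le_of_forall_le _ _ fun m hm => ?_
    rw [scaleHom_monomial]
    exact (Polynomial.natDegree_monomial_le _).trans (mem_weightLE.1 h m hm)
  · refine (Polynomial.le_natDegree_of_ne_zero fun h0 => ?_).trans h
    have := coeff_coeff_scaleHom (w := w) p m
    rw [h0, coeff_zero] at this
    exact mem_support_iff.1 hm this.symm

theorem scaleHom_injective : Function.Injective (scaleHom R w) := by
  refine (injective_iff_map_eq_zero _).2 fun p hp => ?_
  ext m
  rw [← coeff_coeff_scaleHom (w := w), hp]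
  simp

theorem mem_weightLE_of_dvd [IsDomain R] {p q : MvPolynomial σ R} (hpq : p ∣ q) (hq0 : q ≠ 0)
    (hq : q ∈ weightLE R w d) : p ∈ weightLE R w d := by
  obtain ⟨s, rfl⟩ := hpq
  rw [mem_weightLE_iff_natDegree] at hq ⊢
  have h0 : ∀ x : MvPolynomial σ R, x ≠ 0 → scaleHom R w x ≠ 0 := fun x hx =>
    (map_ne_zero_iff _ scaleHom_injective).2 hx
  rw [map_mul, Polynomial.natDegree_mul (h0 _ (left_ne_zero_of_mul hq0))
    (h0 _ (right_ne_zero_of_mul hq0))] at hq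
  omega

/-- Polynomials in an auxiliary variable whose coefficients have weight at most `d`. -/
theorem coeff_mul_mem_weightLE {p q : Polynomial (MvPolynomial σ R)}
    (hp : ∀ k, p.coeff k ∈ weightLE R w d) (hq : ∀ k, q.coeff k ∈ weightLE R w e) (k : ℕ) :
    (p * q).coeff k ∈ weightLE R w (d + e) := by
  rw [Polynomial.coeff_mul]
  exact Submodule.sum_mem _ fun x _ => mul_mem_weightLE (hp _) (hq _)

theorem coeff_pow_mem_weightLE {p : Polynomial (MvPolynomial σ R)}
    (hp : ∀ k, p.coeff k ∈ weightLE R w d) (j k : ℕ) :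
    (p ^ j).coeff k ∈ weightLE R w (j * d) := by
  induction j generalizing k with
  | zero =>
    rw [pow_zero, Polynomial.coeff_one]
    split_ifs
    · exact C_mem_weightLE (1 : R)
    · exact zero_mem _
  | succ j ih => rw [pow_succ, Nat.succ_mul]; exact coeff_mul_mem_weightLE ih hp k

theorem coeff_prod_mem_weightLE {ι : Type*} (s : Finset ι)
    {p : ι → Polynomial (MvPolynomial σ R)} {d : ι → ℕ}
    (hp : ∀ i ∈ s, ∀ k, (p i).coeff k ∈ weightLE R w (d i)) (k : ℕ) :
    (∏ i ∈ s, p i).coeff k ∈ weightLE R w (∑ i ∈ s, d i) := by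
  classical
  induction s using Finset.induction_on generalizing k with
  | empty =>
    rw [Finset.prod_empty, Polynomial.coeff_one]
    split_ifs
    · exact C_mem_weightLE (1 : R)
    · exact zero_mem _
  | insert a s ha ih =>
    rw [Finset.prod_insert ha, Finset.sum_insert ha]
    exact coeff_mul_mem_weightLE (hp a (by simp)) (ih fun i hi => hp i (by simp [hi])) k

end WeightLE

theorem exists_coeff_ne_zero_of_map_eq_zero {A B : Type*} [CommRing A] [CommRing B]
    (χ : Polynomial A →+* Polynomial B) (hX : χ Polynomial.X = Polynomial.X) (η : A →+* B)
    (hη : ∀ a, (χ (Polynomial.C a)).coeff 0 = η a) {p : Polynomial A} (hp : p ≠ 0)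
    (h : χ p = 0) : ∃ k, p.coeff k ≠ 0 ∧ η (p.coeff k) = 0 := by
  refine ⟨p.natTrailingDegree, ?_, ?_⟩
  · exact fun h0 => hp (Polynomial.trailingCoeff_eq_zero.1 h0)
  · obtain ⟨q, hq⟩ : Polynomial.X ^ p.natTrailingDegree ∣ p :=
      Polynomial.X_pow_dvd_iff.2 fun d hd => Polynomial.coeff_eq_zero_of_lt_natTrailingDegree hd
    have hc : p.coeff p.natTrailingDegree = q.coeff 0 := by
      have := congrArg (fun f => f.coeff (0 + p.natTrailingDegree)) hq
      simpa only [zero_add] using this.trans (Polynomial.coeff_X_pow_mul _ _ _)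
    have hχ : χ q = 0 := by
      rw [hq, map_mul, map_pow, hX] at h
      ext j
      simpa using congrArg (fun f => f.coeff (j + p.natTrailingDegree)) h
    rw [hc, ← hη]
    have := congrArg (fun f => (χ f).coeff 0) q.divX_mul_X_add
    simpa [hX, hχ] using this

theorem Polynomial.dvd_of_prime_of_map_eq_zero {A B : Type*} [CommRing A] [IsDomain A]
    [UniqueFactorizationMonoid A] [CommRing B] [IsDomain B] (φ : Polynomial A →+* B)
    (hφ : ∀ a, φ (Polynomial.C a) = 0 → a = 0) {p q : Polynomial A} (hp : Prime p)
    (hp0 : φ p = 0) (hq0 : φ q = 0) : p ∣ q := by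
  obtain ⟨_⟩ : Nonempty (NormalizedGCDMonoid A) := inferInstance
  have hdeg : p.natDegree ≠ 0 := fun h => by
    rw [Polynomial.eq_C_of_natDegree_eq_zero h] at hp0
    apply hp.ne_zero
    rw [Polynomial.eq_C_of_natDegree_eq_zero h, hφ _ hp0, map_zero]
  have hprim : p.IsPrimitive := hp.irreducible.isPrimitive hdeg
  let F := FractionRing A
  have hirr : Irreducible (p.map (algebraMap A F)) :=
    hprim.irreducible_iff_irreducible_map_fraction_map.1 hp.irreducible
  let j : A →+* FractionRing B := (algebraMap B (FractionRing B)).comp (φ.comp Polynomial.C)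
  have hj : Function.Injective j := (injective_iff_map_eq_zero _).2 fun a ha =>
    hφ a ((map_eq_zero_iff _ (IsFractionRing.injective B (FractionRing B))).1 ha)
  let ψ : Polynomial F →+* FractionRing B :=
    Polynomial.eval₂RingHom (IsFractionRing.lift hj) (algebraMap B _ (φ Polynomial.X))
  have hψ : ψ.comp (Polynomial.mapRingHom (algebraMap A F)) =
      (algebraMap B (FractionRing B)).comp φ := by
    apply Polynomial.ringHom_ext
    · intro a
      simp [ψ, F, j]
    · simp [ψ]
  have hψ0 : ∀ r, φ r = 0 → ψ (r.map (algebraMap A F)) = 0 := fun r hr => by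
    have := RingHom.congr_fun hψ r
    simpa [hr] using this
  by_contra hndvd
  have hcop : IsCoprime (p.map (algebraMap A F)) (q.map (algebraMap A F)) := by
    rw [hirr.coprime_iff_not_dvd]
    intro hdvd
    obtain rfl | hq := eq_or_ne q 0
    · exact hndvd (dvd_zero _)
    rw [q.eq_C_content_mul_primPart, Polynomial.map_mul, Polynomial.map_C] at hdvd
    have hu : IsUnit (Polynomial.C (algebraMap A F q.content)) := by
      refine Polynomial.isUnit_C.2 (isUnit_iff_ne_zero.2 ?_)
      rw [Ne, map_eq_zero_iff _ (IsFractionRing.injective A F), Polynomial.content_eq_zero_iff]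
      exact hq
    rw [hu.dvd_mul_left] at hdvd
    have h1 := (hprim.dvd_iff_fraction_map_dvd_fraction_map F).2 hdvd
    refine hndvd ?_
    rw [q.eq_C_content_mul_primPart]
    exact h1.mul_left _
  obtain ⟨a, b, hab⟩ := hcop
  have := congrArg ψ hab
  rw [map_add, map_mul, map_mul, hψ0 _ hp0, hψ0 _ hq0] at this
  simp at this

theorem MvPolynomial.dvd_of_prime_of_map_eq_zero {K σ κ B : Type*} [Field K] [CommRing B]
    [IsDomain B] (e : Option κ ≃ σ) (φ : MvPolynomial σ K →+* B)
    (hφ : ∀ a : MvPolynomial κ K, φ (rename (fun i => e (some i)) a) = 0 → a = 0)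
    {p q : MvPolynomial σ K} (hp : Prime p) (hp0 : φ p = 0) (hq0 : φ q = 0) : p ∣ q := by
  let E : MvPolynomial σ K ≃ₐ[K] Polynomial (MvPolynomial κ K) :=
    (renameEquiv K e.symm).trans (optionEquivLeft K κ)
  have hE : ∀ a : MvPolynomial κ K,
      E.symm (Polynomial.C a) = rename (fun i => e (some i)) a := by
    intro a
    rw [AlgEquiv.symm_apply_eq]
    have : (Polynomial.CAlgHom : MvPolynomial κ K →ₐ[MvPolynomial κ K] _).restrictScalars K =
        E.toAlgHom.comp (rename fun i => e (some i)) := by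
      ext i
      simp [E]
    exact DFunLike.congr_fun this a
  have := Polynomial.dvd_of_prime_of_map_eq_zero (φ.comp (E.symm : _ →+* _))
    (fun a ha => hφ a (by rw [← hE]; exact ha)) (p := E p) (q := E q)
    ((MulEquiv.prime_iff E.toMulEquiv).2 hp) (by simpa using hp0) (by simpa using hq0)
  exact (map_dvd_iff E).1 this

section Lie

variable {σ K : Type*} [Field K] [CharZero K] {w : σ → ℕ} {e : ℕ}

theorem derivation_mem_weightLE (L : Derivation ℚ (MvPolynomial σ K) (MvPolynomial σ K))
    (hLX : ∀ i, L (X i) ∈ weightLE K w (w i + e)) (hLC : ∀ c : K, ∃ c' : K, L (C c) = C c')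
    {d : ℕ} {p : MvPolynomial σ K} (hp : p ∈ weightLE K w d) : L p ∈ weightLE K w (d + e) := by
  have key : ∀ (m : σ →₀ ℕ) (c : K),
      L (monomial m c) ∈ weightLE K w (Finsupp.weight w m + e) := by
    intro m
    induction m using Finsupp.induction_linear with
    | zero =>
      intro c
      obtain ⟨c', hc'⟩ := hLC c
      rw [show monomial (0 : σ →₀ ℕ) c = C c from rfl, hc']
      exact C_mem_weightLE c'
    | add f g hf hg =>
      intro c
      rw [show monomial (f + g) c = monomial f c * monomial g (1 : K) by simp,
        Derivation.leibniz, smul_eq_mul, smul_eq_mul, map_add]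
      refine add_mem ?_ ?_
      · rw [add_assoc]
        exact mul_mem_weightLE (monomial_mem_weightLE le_rfl _) (hg 1)
      · rw [add_comm (Finsupp.weight w f), add_assoc]
        exact mul_mem_weightLE (monomial_mem_weightLE le_rfl _) (hf c)
    | single i k =>
      intro c
      have h1 : monomial (Finsupp.single i k) c = C c * X i ^ k := by
        rw [C_mul_X_pow_eq_monomial]
      obtain ⟨c', hc'⟩ := hLC c
      rw [h1, Derivation.leibniz, Derivation.leibniz_pow, hc', Finsupp.weight_single]
      simp only [smul_eq_mul]
      refine add_mem ?_ ?_
      · rcases k with _ | k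
        · simp
        · have h2 : X i ^ k * L (X i) ∈ weightLE K w (k * w i + (w i + e)) :=
            mul_mem_weightLE (pow_mem_weightLE (X_mem_weightLE le_rfl) k) (hLX i)
          have h3 := mul_mem_weightLE (C_mem_weightLE (w := w) (d := 0) c)
            (Submodule.smul_of_tower_mem _ (k + 1) h2)
          refine weightLE_mono ?_ h3
          rw [Nat.succ_mul]; omega
      · have h2 : X i ^ k * C c' ∈ weightLE K w (k * w i + e) :=
          mul_mem_weightLE (pow_mem_weightLE (X_mem_weightLE le_rfl) k) (C_mem_weightLE c')
        exact h2
  rw [p.as_sum, map_sum]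
  exact Submodule.sum_mem _ fun m hm =>
    weightLE_mono (Nat.add_le_add_right (mem_weightLE.1 hp m hm) e) (key m _)

theorem iterate_derivation_mem_weightLE
    (L : Derivation ℚ (MvPolynomial σ K) (MvPolynomial σ K))
    (hLX : ∀ i, L (X i) ∈ weightLE K w (w i + e)) (hLC : ∀ c : K, ∃ c' : K, L (C c) = C c')
    {d : ℕ} {p : MvPolynomial σ K} (hp : p ∈ weightLE K w d) (k : ℕ) :
    (⇑L)^[k] p ∈ weightLE K w (d + k * e) := by
  induction k with
  | zero => simpa using hp
  | succ k ih =>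
    rw [Function.iterate_succ_apply', Nat.succ_mul, ← add_assoc]
    exact derivation_mem_weightLE L hLX hLC ih

end Lie

theorem le_of_forall_mul_le_mul_add {N B c n : ℕ} (hB : 0 < B) {V : ℕ → ℕ} (hV0 : 0 < V 0)
    (hV : ∀ D, V D ≤ (D + 1) ^ n) (h : ∀ D, N * V D ≤ B * V (D + c)) : N ≤ B := by
  by_contra! hlt
  have hpow : ∀ j, (B + 1) ^ j ≤ B ^ j * V (j * c) := by
    intro j
    induction j with
    | zero => simpa using Nat.succ_le_of_lt hV0
    | succ j ih =>
      calc (B + 1) ^ (j + 1) = (B + 1) * (B + 1) ^ j := by ring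
        _ ≤ (B + 1) * (B ^ j * V (j * c)) := Nat.mul_le_mul_left _ ih
        _ = B ^ j * ((B + 1) * V (j * c)) := by ring
        _ ≤ B ^ j * (B * V (j * c + c)) :=
          Nat.mul_le_mul_left _ ((Nat.mul_le_mul_right _ hlt).trans (h _))
        _ = B ^ (j + 1) * V ((j + 1) * c) := by rw [Nat.succ_mul]; ring
  have hB' : (0 : ℝ) < B := by exact_mod_cast hB
  have hr : (1 : ℝ) < ((B : ℝ) + 1) / B := by rw [lt_div_iff₀ hB']; linarith
  have hlim := (tendsto_pow_const_div_const_pow_of_one_lt n hr).const_mul (((c : ℝ) + 1) ^ n)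
  rw [mul_zero] at hlim
  have hge : ∀ᶠ j : ℕ in Filter.atTop,
      (1 : ℝ) ≤ ((c : ℝ) + 1) ^ n * ((j : ℝ) ^ n / (((B : ℝ) + 1) / B) ^ j) := by
    filter_upwards [Filter.eventually_ge_atTop 1] with j hj
    have h1 : (B + 1) ^ j ≤ B ^ j * ((c + 1) * j) ^ n :=
      (hpow j).trans (Nat.mul_le_mul_left _ ((hV _).trans (Nat.pow_le_pow_left (by nlinarith) n)))
    have h2 : ((B : ℝ) + 1) ^ j ≤ (B : ℝ) ^ j * (((c : ℝ) + 1) * j) ^ n := by exact_mod_cast h1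
    rw [← mul_div_assoc, le_div_iff₀ (by positivity), one_mul, div_pow, div_le_iff₀ (by positivity),
      ← mul_pow, mul_comm]
    exact h2
  have := ge_of_tendsto hlim hge
  linarith

/-- The exponent vectors of total degree at most `D`. -/
def simplexExp (ι : Type*) [Fintype ι] [DecidableEq ι] (D : ℕ) : Finset (ι → ℕ) :=
  (Fintype.piFinset fun _ => Finset.range (D + 1)).filter fun m => ∑ i, m i ≤ D

section Simplex

variable {ι : Type*} [Fintype ι] [DecidableEq ι] {D : ℕ}

theorem mem_simplexExp {m : ι → ℕ} : m ∈ simplexExp ι D ↔ ∑ i, m i ≤ D := by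
  simp only [simplexExp, Finset.mem_filter, Fintype.mem_piFinset, Finset.mem_range,
    and_iff_right_iff_imp]
  intro h i
  exact Nat.lt_succ_of_le
    ((Finset.single_le_sum (f := m) (fun _ _ => Nat.zero_le _) (Finset.mem_univ i)).trans h)

theorem card_simplexExp_le : (simplexExp ι D).card ≤ (D + 1) ^ Fintype.card ι :=
  (Finset.card_filter_le _ _).trans (by simp)

theorem card_simplexExp_congr {κ : Type*} [Fintype κ] [DecidableEq κ] (e : ι ≃ κ) :
    (simplexExp ι D).card = (simplexExp κ D).card := by
  refine Finset.card_bij' (fun m _ => m ∘ e.symm) (fun m _ => m ∘ e) ?_ ?_ ?_ ?_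
  · intro m hm
    rw [mem_simplexExp] at hm ⊢
    simpa [Equiv.sum_comp e.symm m] using hm
  · intro m hm
    rw [mem_simplexExp] at hm ⊢
    simpa [Equiv.sum_comp e m] using hm
  · intro m _; ext; simp
  · intro m _; ext; simp

theorem card_simplexExp_le_prod_mul {b : ι → ℕ} (hb : ∀ i, 1 ≤ b i) :
    (simplexExp ι D).card ≤
      (∏ i, b i) * ((simplexExp ι D).filter fun m => ∑ i, b i * m i ≤ D).card := by
  have : ∏ i, b i = (Fintype.piFinset fun i => Finset.range (b i)).card := by simp
  rw [this, ← Finset.card_product]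
  refine Finset.card_le_card_of_injOn (fun m => (fun i => m i % b i, fun i => m i / b i)) ?_ ?_
  · intro m hm
    have hm := mem_simplexExp.1 hm
    simp only [Finset.coe_product, Set.mem_prod, Finset.mem_coe, Fintype.mem_piFinset,
      Finset.mem_range, Finset.mem_filter, mem_simplexExp]
    exact ⟨fun i => Nat.mod_lt _ (hb i),
      (Finset.sum_le_sum fun i _ => Nat.div_le_self _ _).trans hm,
      (Finset.sum_le_sum fun i _ => Nat.mul_div_le _ _).trans hm⟩
  · intro m _ m' _ h
    simp only [Prod.mk.injEq, funext_iff] at h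
    ext i
    rw [← Nat.mod_add_div (m i) (b i), ← Nat.mod_add_div (m' i) (b i), h.1 i, h.2 i]

end Simplex

theorem le_prod_of_linearIndependent_adjoin {k κ τ : Type*} [CommRing k] [Nontrivial k]
    [Fintype κ] [Fintype τ] (hc : Fintype.card κ = Fintype.card τ) {g : κ → MvPolynomial τ k}
    {b : κ → ℕ} (hb : ∀ i, 1 ≤ b i) (hg : ∀ i, g i ∈ weightLE k 1 (b i)) {N : ℕ}
    {e : Fin N → MvPolynomial τ k}
    (he : ∀ a : Fin N → MvPolynomial κ k, ∑ s, aeval g (a s) * e s = 0 → a = 0) :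
    N ≤ ∏ i, b i := by
  classical
  obtain ⟨c, hc'⟩ : ∃ c, ∀ s, e s ∈ weightLE k 1 c := by
    refine ⟨Finset.univ.sup fun s => (e s).support.sup (Finsupp.weight 1), fun s => ?_⟩
    refine mem_weightLE.2 fun m hm => ?_
    exact (Finset.le_sup (f := Finsupp.weight 1) hm).trans
      (Finset.le_sup (f := fun s => (e s).support.sup (Finsupp.weight 1)) (Finset.mem_univ s))
  refine le_of_forall_mul_le_mul_add (c := c) (n := Fintype.card τ)
    (V := fun D => (simplexExp τ D).card) (Finset.prod_pos fun i _ => hb i) ?_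
    (fun D => card_simplexExp_le) fun D => ?_
  · exact Finset.card_pos.2 ⟨0, mem_simplexExp.2 (by simp)⟩
  let M := (simplexExp κ D).filter fun m => ∑ i, b i * m i ≤ D
  suffices hM : N * M.card ≤ (simplexExp τ (D + c)).card by
    calc N * (simplexExp τ D).card = N * (simplexExp κ D).card := by
          rw [card_simplexExp_congr (Fintype.equivOfCardEq hc)]
      _ ≤ N * ((∏ i, b i) * M.card) := Nat.mul_le_mul_left _ (card_simplexExp_le_prod_mul hb)
      _ = (∏ i, b i) * (N * M.card) := by ring
      _ ≤ _ := Nat.mul_le_mul_left _ hM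
  let mon : (κ → ℕ) → MvPolynomial κ k := fun m => monomial (Finsupp.equivFunOnFinite.symm m) 1
  let v : Fin N × M → (simplexExp τ (D + c) → k) := fun x t =>
    coeff (Finsupp.equivFunOnFinite.symm (t : τ → ℕ)) (aeval g (mon x.2) * e x.1)
  have hdeg : ∀ x : Fin N × M, aeval g (mon x.2) * e x.1 ∈ weightLE k 1 (D + c) := by
    intro x
    refine mul_mem_weightLE ?_ (hc' _)
    have hx := (Finset.mem_filter.1 x.2.2).2
    rw [aeval_monomial, map_one, one_mul, Finsupp.prod_fintype _ _ (by simp)]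
    refine weightLE_mono hx (prod_mem_weightLE _ fun i _ => ?_)
    rw [mul_comm]
    exact pow_mem_weightLE (hg i) _
  have hv : LinearIndependent k v := by
    refine Fintype.linearIndependent_iff.2 fun l hl => ?_
    have hpoly : ∑ x, C (l x) * (aeval g (mon x.2) * e x.1) = 0 := by
      ext t
      by_cases ht : ∑ i, t i ≤ D + c
      · have := congrFun hl ⟨⇑t, mem_simplexExp.2 ht⟩
        simpa [v, coeff_sum, Finset.sum_apply] using this
      · have hmem : ∑ x, C (l x) * (aeval g (mon x.2) * e x.1) ∈ weightLE k 1 (D + c) :=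
          Submodule.sum_mem _ fun x _ => by
            rw [← smul_eq_C_mul]; exact Submodule.smul_mem _ _ (hdeg x)
        rw [coeff_zero, ← notMem_support_iff]
        intro h
        apply ht
        have := mem_weightLE.1 hmem t h
        rw [Finsupp.weight_apply, Finsupp.sum_fintype _ _ (by simp)] at this
        simpa using this
    have h0 := he (fun s => ∑ m : M, C (l (s, m)) * mon m) (by
      rw [← hpoly, Fintype.sum_prod_type]
      refine Finset.sum_congr rfl fun s _ => ?_
      rw [map_sum, Finset.sum_mul]
      refine Finset.sum_congr rfl fun m _ => ?_
      rw [map_mul, aeval_C, mul_assoc]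
      rfl)
    rintro ⟨s, m⟩
    have := congrArg (coeff (Finsupp.equivFunOnFinite.symm (m : κ → ℕ))) (congrFun h0 s)
    rw [Pi.zero_apply, coeff_zero, coeff_sum, Finset.sum_eq_single m] at this
    · simpa [mon] using this
    · intro m' _ hne
      have hne' : (m' : κ → ℕ) ≠ m := fun h => hne (Subtype.ext h)
      simp [mon, coeff_C_mul, coeff_monomial, hne']
    · simp
  simpa using hv.fintype_card_le_finrank

theorem exists_smul_eq_sum_of_not_linearIndependent {A T : Type*} [CommRing A] [AddCommGroup T]
    [Module A T] {N : ℕ} {e : Fin N → T} (he : LinearIndependent A e) {x : T}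
    (hx : ¬ LinearIndependent A (Fin.cons x e : Fin (N + 1) → T)) :
    ∃ d : A, d ≠ 0 ∧ ∃ c : Fin N → A, d • x = ∑ t, c t • e t := by
  obtain ⟨l, hl, i, hi⟩ := Fintype.not_linearIndependent_iff.1 hx
  rw [Fin.sum_univ_succ] at hl
  simp only [Fin.cons_zero, Fin.cons_succ] at hl
  refine ⟨l 0, fun h0 => hi ?_, fun t => - l t.succ, ?_⟩
  · rw [h0, zero_smul, zero_add] at hl
    have := Fintype.linearIndependent_iff.1 he _ hl
    exact Fin.cases h0 this i
  · simpa [neg_smul, Finset.sum_neg_distrib] using eq_neg_of_add_eq_zero_left hl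

theorem exists_ne_zero_smul_eq_sum {A T I : Type*} [CommRing A] [IsDomain A] [AddCommGroup T]
    [Module A T] [Fintype I] {N : ℕ} {e : Fin N → T} (x : I → T)
    (h : ∀ i, ∃ d : A, d ≠ 0 ∧ ∃ c : Fin N → A, d • x i = ∑ t, c t • e t) :
    ∃ d : A, d ≠ 0 ∧ ∀ i, ∃ c : Fin N → A, d • x i = ∑ t, c t • e t := by
  classical
  choose d hd c hc using h
  refine ⟨∏ i, d i, Finset.prod_ne_zero_iff.2 fun i _ => hd i, fun i => ?_⟩
  obtain ⟨z, hz⟩ := Finset.dvd_prod_of_mem d (Finset.mem_univ i)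
  refine ⟨fun t => z * c i t, ?_⟩
  rw [hz, mul_comm, mul_smul, hc, Finset.smul_sum]
  simp [mul_smul]

theorem exists_eliminant {A T S : Type*} [CommRing A] [IsDomain A] [CommRing T] [IsDomain T]
    [Algebra A T] [Fintype S] {B : ℕ}
    (hB : ∀ (N : ℕ) (e : Fin N → T), LinearIndependent A e → N ≤ B) (q : S → T) :
    ∃ D : MvPolynomial (Option S) A, D ≠ 0 ∧ D ∈ weightLE A 1 B ∧
      aeval (fun o : Option S => o.elim (- ∑ s, X s * C (q s)) X) D =
        (0 : MvPolynomial S T) := by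
  classical
  by_cases hinj : Function.Injective (algebraMap A T)
  swap
  · rw [injective_iff_map_eq_zero] at hinj
    push Not at hinj
    obtain ⟨a, ha, ha0⟩ := hinj
    refine ⟨C a, (map_ne_zero_iff _ (C_injective _ _)).2 ha0, C_mem_weightLE a, ?_⟩
    rw [aeval_C, MvPolynomial.algebraMap_apply, ha, map_zero]
  have := (faithfulSMul_iff_algebraMap_injective A T).2 hinj
  let p : ℕ → Prop := fun N => ∃ e : Fin N → T, LinearIndependent A e
  have hp1 : p 1 := ⟨fun _ => 1, LinearIndependent.of_subsingleton 0 one_ne_zero⟩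
  have h1B : 1 ≤ B := hB _ _ hp1.choose_spec
  obtain ⟨e, he⟩ : p (Nat.findGreatest p B) := Nat.findGreatest_spec h1B hp1
  have hmax : ∀ x : T, ¬ LinearIndependent A
      (Fin.cons x e : Fin (Nat.findGreatest p B + 1) → T) := fun x hx => by
    have := Nat.le_findGreatest (P := p) (hB _ _ hx) ⟨_, hx⟩
    omega
  have hpos : 0 < Nat.findGreatest p B := Nat.le_findGreatest h1B hp1
  have hNB : Nat.findGreatest p B ≤ B := Nat.findGreatest_le B
  generalize Nat.findGreatest p B = N at e he hmax hpos hNB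
  obtain ⟨d, hd, hdx⟩ := exists_ne_zero_smul_eq_sum (A := A) (e := e)
    (fun i : S × Fin N => q i.1 * e i.2)
    fun i => exists_smul_eq_sum_of_not_linearIndependent he (hmax _)
  choose c hc using hdx
  let M : Matrix (Fin N) (Fin N) (MvPolynomial (Option S) A) := Matrix.of fun s t =>
    (if s = t then C d * X none else 0) + ∑ o, X (some o) * C (c (o, s) t)
  refine ⟨M.det, fun h0 => ?_, ?_, ?_⟩
  · let ev : MvPolynomial (Option S) A →+* A := eval fun o => o.elim 1 fun _ => 0
    have := congrArg ev h0
    rw [RingHom.map_det, map_zero] at this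
    have hM : ev.mapMatrix M = Matrix.scalar (Fin N) d := by
      ext s t
      simp only [ev, M, RingHom.mapMatrix_apply, Matrix.map_apply, Matrix.of_apply,
        Matrix.scalar_apply, Matrix.diagonal_apply]
      split_ifs <;> simp
    rw [hM, Matrix.scalar_apply, Matrix.det_diagonal] at this
    simp [hd] at this
  · rw [Matrix.det_apply]
    refine Submodule.sum_mem _ fun σ _ => ?_
    refine Submodule.smul_of_tower_mem _ _ ?_
    have : ∏ i, M (σ i) i ∈ weightLE A 1 (∑ _i : Fin N, 1) :=
      prod_mem_weightLE _ fun i _ => by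
        refine add_mem ?_ (Submodule.sum_mem _ fun o _ => ?_)
        · split_ifs
          · exact mul_mem_weightLE (d := 0) (C_mem_weightLE d) (X_mem_weightLE le_rfl)
          · exact zero_mem _
        · exact mul_mem_weightLE (e := 0) (X_mem_weightLE le_rfl) (C_mem_weightLE _)
    exact weightLE_mono (by simpa using hNB) this
  · let Θ : MvPolynomial (Option S) A →ₐ[A] MvPolynomial S T :=
      aeval (fun o : Option S => o.elim (- ∑ s, X s * C (q s)) X)
    change Θ M.det = 0
    rw [AlgHom.map_det, ← Matrix.exists_mulVec_eq_zero_iff]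
    refine ⟨fun s => C (e s), fun h => ?_, ?_⟩
    · have := congrFun h ⟨0, hpos⟩
      exact he.ne_zero ⟨0, hpos⟩ (C_injective S T (this.trans (map_zero C).symm))
    · ext1 s
      have hC : ∀ a : A, Θ (C a) = C (algebraMap A T a) := fun a => by
        rw [← algebraMap_eq, Θ.commutes]; rfl
      have hsum : ∀ o, ∑ t, C (algebraMap A T (c (o, s) t)) * C (e t) =
          (C (algebraMap A T d) * (C (q o) * C (e s)) : MvPolynomial S T) := fun o => by
        have := congrArg (C : T →+* MvPolynomial S T) (hc (o, s))
        simpa [Algebra.smul_def] using this.symm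
      have hX : Θ (X none) = - ∑ s, X s * C (q s) := by simp [Θ]
      have hXs : ∀ o, Θ (X (some o)) = X o := fun o => by simp [Θ]
      simp only [Matrix.mulVec, dotProduct, AlgHom.mapMatrix_apply, Matrix.map_apply, M, Matrix.of_apply, map_add,
        map_sum, map_mul, hXs, hC, apply_ite Θ, hX, map_zero, Pi.zero_apply, add_mul,
        Finset.sum_add_distrib, ite_mul, zero_mul, Finset.sum_ite_eq, Finset.mem_univ, if_true,
        Finset.sum_mul, mul_assoc]
      rw [Finset.sum_comm]
      simp only [← Finset.mul_sum, hsum]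
      rw [neg_mul, mul_neg, Finset.sum_mul, Finset.mul_sum, neg_add_eq_zero]
      exact Finset.sum_congr rfl fun o _ => by ring

section Generic

variable {K ι τ S : Type*} [Field K] [Fintype S]

/-- For the generic polynomials `F i = u (i, none) + ∑ s, u (i, some s) * q i s`, the homomorphism
solving `F i = 0` for `u (i, none)`; its kernel consists of the relations between coefficients
forced by a common zero. -/
noncomputable def genericHom (q : ι → S → MvPolynomial τ K) :
    MvPolynomial (ι × Option S) K →ₐ[K] MvPolynomial τ (MvPolynomial (ι × S) K) :=
  aeval fun x => x.2.elim (- ∑ s, C (X (x.1, s)) * map C (q x.1 s)) fun s => C (X (x.1, s))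

variable {q : ι → S → MvPolynomial τ K} {b : ι → ℕ}

theorem map_mem_weightLE {σ R R' : Type*} [CommRing R] [CommRing R'] (f : R →+* R') {w : σ → ℕ}
    {d : ℕ} {p : MvPolynomial σ R} (hp : p ∈ weightLE R w d) : map f p ∈ weightLE R' w d :=
  mem_weightLE.2 fun m hm => mem_weightLE.1 hp m (support_map_subset f p hm)

theorem ringHom_mem_weightLE {σ σ' R R' : Type*} [CommRing R] [CommRing R']
    (F : MvPolynomial σ R →+* MvPolynomial σ' R') {v : σ → ℕ} {w : σ' → ℕ} {d : ℕ}
    (hC : ∀ a, F (C a) ∈ weightLE R' w 0) (hX : ∀ i, F (X i) ∈ weightLE R' w (v i))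
    {p : MvPolynomial σ R} (hp : p ∈ weightLE R v d) : F p ∈ weightLE R' w d := by
  rw [p.as_sum, map_sum]
  refine Submodule.sum_mem _ fun m hm => weightLE_mono (mem_weightLE.1 hp m hm) ?_
  rw [monomial_eq, map_mul, Finsupp.prod, map_prod, ← zero_add (Finsupp.weight _ _),
    Finsupp.weight_apply]
  refine mul_mem_weightLE (hC _) (prod_mem_weightLE _ fun i _ => ?_)
  rw [map_pow]
  exact pow_mem_weightLE (hX i) _

theorem mem_weightLE_zero {σ R : Type*} [CommRing R] (p : MvPolynomial σ R) :
    p ∈ weightLE R 0 0 :=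
  mem_weightLE.2 fun m _ => by simp [Finsupp.weight_apply]

theorem exists_ringHom {σ R R' : Type*} [CommRing R] [CommRing R'] (f : R →+* R') (g : σ → R') :
    ∃ F : MvPolynomial σ R →+* R', (∀ a, F (C a) = f a) ∧ ∀ i, F (X i) = g i :=
  ⟨eval₂Hom f g, fun a => eval₂Hom_C f g a, fun i => eval₂Hom_X' f g i⟩

theorem genericHom_X (x : ι × Option S) : genericHom q (X x) =
    x.2.elim (- ∑ s, C (X (x.1, s)) * map C (q x.1 s)) fun s => C (X (x.1, s)) := by
  rw [genericHom, aeval_X]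

theorem genericHom_C (c : K) : genericHom q (C c) = C (C c) := by
  rw [genericHom, aeval_C]
  rfl

theorem exists_generic_eliminant [Fintype ι] [Fintype τ] [DecidableEq ι] (i₀ : ι)
    (hcard : Fintype.card {i // i ≠ i₀} = Fintype.card τ)
    (hb : ∀ i, 1 ≤ b i) (hq : ∀ i s, q i s ∈ weightLE K 1 (b i)) :
    ∃ D, D ≠ 0 ∧ genericHom q D = 0 ∧
      D ∈ weightLE K (fun x : ι × Option S => if x.1 = i₀ then 1 else 0)
        (∏ j ∈ Finset.univ.erase i₀, b j) := by
  let κ := {i // i ≠ i₀}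
  let k := MvPolynomial (κ × S) K
  let A := MvPolynomial κ k
  let T := MvPolynomial τ k
  let g : κ → T := fun i => - ∑ s, C (X (i, s)) * map C (q i s)
  let gA : A →+* T := (aeval g : A →ₐ[k] T).toRingHom
  have hgAC : ∀ a : k, gA (C a) = C a := fun a => aeval_C g a
  have hgAX : ∀ i, gA (X i) = - ∑ s, C (X (i, s)) * map C (q i s) := fun i => aeval_X g i
  let _ : Algebra A T := gA.toAlgebra
  have halg : ∀ a : A, algebraMap A T a = gA a := fun _ => rfl
  have hg : ∀ i : κ, g i ∈ weightLE k 1 (b i) := fun i => by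
    refine neg_mem (Submodule.sum_mem _ fun s _ => ?_)
    rw [← smul_eq_C_mul]
    exact Submodule.smul_mem _ _ (map_mem_weightLE _ (hq i s))
  have hB : ∀ (N : ℕ) (e : Fin N → T), LinearIndependent A e → N ≤ ∏ i : κ, b i := by
    intro N e he
    refine le_prod_of_linearIndependent_adjoin hcard (fun i => hb i) hg (e := e) fun a ha => ?_
    ext1 s
    refine Fintype.linearIndependent_iff.1 he a ?_ s
    simp only [Algebra.smul_def, halg]
    exact ha
  obtain ⟨D, hD0, hDw, hDz⟩ := exists_eliminant hB fun s => map C (q i₀ s)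
  obtain ⟨θk, hθkC, hθkX⟩ := exists_ringHom (C : K →+* MvPolynomial (ι × Option S) K)
    fun x : κ × S => X ((x.1 : ι), some x.2)
  obtain ⟨θA, hθAC, hθAX⟩ := exists_ringHom θk fun i : κ => X ((i : ι), none)
  obtain ⟨θ, hθC, hθX⟩ := exists_ringHom θA fun o : Option S => X (i₀, o)
  obtain ⟨ξ, hξC, hξX⟩ := exists_ringHom ((C.comp C).comp C : K →+* MvPolynomial (Option S) A)
    fun x : ι × Option S => if h : x.1 = i₀ then (X x.2 : MvPolynomial (Option S) A) else
      x.2.elim (C (X (⟨x.1, h⟩ : κ))) fun s => C (C (X ((⟨x.1, h⟩, s) : κ × S)))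
  let ρ : k →+* MvPolynomial (ι × S) K :=
    (rename fun x : κ × S => ((x.1 : ι), x.2) : k →ₐ[K] _).toRingHom
  have hρC : ∀ a, ρ (C a) = C a := fun a => rename_C _ a
  have hρX : ∀ x, ρ (X x) = X ((x.1 : ι), x.2) := fun x => rename_X _ x
  let ω : T →+* MvPolynomial τ (MvPolynomial (ι × S) K) := map ρ
  have hωC : ∀ a, ω (C a) = C (ρ a) := fun a => map_C ρ a
  have hωX : ∀ i, ω (X i) = X i := fun a => map_X ρ a
  obtain ⟨Ω, hΩC, hΩX⟩ := exists_ringHom ω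
    fun s : S => (C (X (i₀, s)) : MvPolynomial τ (MvPolynomial (ι × S) K))
  have hωmap : ∀ p : MvPolynomial τ K, ω (map C p) = map C p := fun p => by
    refine RingHom.congr_fun (f := ω.comp (map C)) (ringHom_ext (fun a => ?_) fun j => ?_) p
    · rw [RingHom.comp_apply, map_C, map_C, hρC, map_C]
    · rw [RingHom.comp_apply, map_X, map_X, map_X]
  have hθξ : ∀ p, ξ (θ p) = p := by
    refine RingHom.congr_fun (f := ξ.comp θ) (g := RingHom.id _)
      (ringHom_ext (fun a => ?_) fun o => ?_)
    · refine RingHom.congr_fun (f := (ξ.comp θ).comp C) (g := C)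
        (ringHom_ext (fun a => ?_) fun i => ?_) a
      · refine RingHom.congr_fun (f := ((ξ.comp θ).comp C).comp C) (g := C.comp C)
          (ringHom_ext (fun a => ?_) fun x => ?_) a
        · simp only [RingHom.comp_apply, hθC, hθAC, hθkC, hξC]
        · simp only [RingHom.comp_apply, hθC, hθAC, hθkX, hξX, dif_neg x.1.2, Option.elim_some]
          rfl
      · simp only [RingHom.comp_apply, hθC, hθAX, hξX, dif_neg i.2, Option.elim_none]
        rfl
    · simp only [RingHom.comp_apply, hθX, hξX, dif_pos, RingHom.id_apply]
  have hΦA : ∀ a : A, genericHom q (θA a) = ω (gA a) := by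
    refine RingHom.congr_fun (f := (genericHom q).toRingHom.comp θA) (g := ω.comp gA)
      (ringHom_ext (fun a => ?_) fun i => ?_)
    · refine RingHom.congr_fun (f := ((genericHom q).toRingHom.comp θA).comp C)
        (g := (ω.comp gA).comp C) (ringHom_ext (fun a => ?_) fun x => ?_) a
      · simp only [RingHom.comp_apply, AlgHom.toRingHom_eq_coe, RingHom.coe_coe, hθAC, hθkC,
          genericHom_C, hgAC, hωC, hρC]
      · simp only [RingHom.comp_apply, AlgHom.toRingHom_eq_coe, RingHom.coe_coe, hθAC, hθkX,
          genericHom_X, hgAC, hωC, hρX, Option.elim_some]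
    · simp only [AlgHom.toRingHom_eq_coe, RingHom.comp_apply, RingHom.coe_coe, hgAX,
        map_neg, map_sum, map_mul, hωmap, hθAX, hωC, hρX, genericHom_X, Option.elim_none]
  refine ⟨θ D, fun h => hD0 ?_, ?_, ?_⟩
  · rw [← hθξ D, h, map_zero]
  · refine (RingHom.congr_fun (f := (genericHom q).toRingHom.comp θ) (g := Ω.comp
        (aeval (fun o : Option S => o.elim (- ∑ s, X s * C (map C (q i₀ s))) X) :
          MvPolynomial (Option S) A →ₐ[A] MvPolynomial S T).toRingHom)
      (ringHom_ext (fun a => ?_) fun o => ?_) D).trans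
      ((congrArg Ω hDz).trans (map_zero _))
    · simp only [AlgHom.toRingHom_eq_coe, RingHom.comp_apply, RingHom.coe_coe, aeval_C,
        MvPolynomial.algebraMap_apply, halg, hθC, hΦA, hΩC]
    · simp only [AlgHom.toRingHom_eq_coe, RingHom.comp_apply, RingHom.coe_coe, aeval_X, hθX,
        genericHom_X]
      cases o <;> simp only [Option.elim_none, Option.elim_some, map_neg, map_sum, map_mul, hΩX,
        hΩC, hωmap]
  · have hprod : ∏ j ∈ Finset.univ.erase i₀, b j = ∏ i : κ, b i :=
      Finset.prod_subtype _ (by simp) b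
    rw [hprod]
    refine ringHom_mem_weightLE θ (v := 1) (fun a => ?_) (fun o => ?_) hDw
    · rw [hθC]
      refine ringHom_mem_weightLE θA (v := 0) (fun a => ?_) (fun i => ?_) (mem_weightLE_zero a)
      · rw [hθAC]
        refine ringHom_mem_weightLE θk (v := 0) (fun a => ?_) (fun i => ?_) (mem_weightLE_zero a)
        · rw [hθkC]
          exact C_mem_weightLE _
        · rw [hθkX]
          exact X_mem_weightLE (by simp [i.1.2])
      · rw [hθAX]
        exact X_mem_weightLE (by simp [i.2])
    · rw [hθX]
      exact X_mem_weightLE (by simp)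

theorem add_mul_neg_sum_eq {A : Type*} [CommRing A] {x : A} (y : A) (u p : S → A) {d : S → A}
    (h : ∑ s, d s * p s = x) : x + y * - ∑ s, u s * p s = - ∑ s, (y * u s - d s) * p s := by
  simp only [sub_mul, Finset.sum_sub_distrib, mul_assoc, ← Finset.mul_sum, h]
  ring

theorem genericHom_rename_injective (e : Option τ ≃ ι) (δ : ι → S → K)
    (hδ : ∀ j, ∑ s, C (δ (e (some j)) s) * q (e (some j)) s = X j)
    {a : MvPolynomial (τ ⊕ ι × S) K}
    (ha : genericHom q (rename
      (Sum.elim (fun j => (e (some j), none)) fun x => (x.1, some x.2)) a) = 0) : a = 0 := by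
  by_contra ha0
  let A := MvPolynomial (τ ⊕ ι × S) K
  let B := MvPolynomial τ (MvPolynomial (ι × S) K)
  obtain ⟨ρ, hρC, hρX⟩ := exists_ringHom (Polynomial.C.comp C : K →+* Polynomial A)
    (Sum.elim (fun j => Polynomial.C (X (Sum.inl j)))
      fun x => Polynomial.X * Polynomial.C (X (Sum.inr x)) - Polynomial.C (C (δ x.1 x.2)))
  obtain ⟨ε, hεC, hεX⟩ := exists_ringHom (C : K →+* A)
    (Sum.elim (fun j => X (Sum.inl j)) fun x => X (Sum.inr x) + C (δ x.1 x.2))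
  have hρ : ∀ p, (ρ p).eval₂ ε 1 = p := by
    refine RingHom.congr_fun (f := (Polynomial.eval₂RingHom ε 1).comp ρ) (g := RingHom.id A)
      (ringHom_ext (fun a => ?_) ?_)
    · simp only [RingHom.comp_apply, hρC, Polynomial.coe_eval₂RingHom, Polynomial.eval₂_C, hεC]
      rfl
    · rintro (j | x)
      · simp only [RingHom.comp_apply, hρX, Polynomial.coe_eval₂RingHom, Polynomial.eval₂_C, hεX,
          Sum.elim_inl]
        rfl
      · simp only [RingHom.comp_apply, hρX, Polynomial.coe_eval₂RingHom, Polynomial.eval₂_C, hεX,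
          Sum.elim_inr, Polynomial.eval₂_sub, Polynomial.eval₂_mul, Polynomial.eval₂_X, hεC,
          one_mul, add_sub_cancel_right]
        rfl
  obtain ⟨ψ, hψC, hψX⟩ := exists_ringHom (σ := τ ⊕ ι × S) (R := K) (R' := Polynomial B)
    ((Polynomial.C.comp C).comp C)
    (Sum.elim (fun j : τ => (Polynomial.C (X j) : Polynomial B) +
        Polynomial.X * Polynomial.C (- ∑ s, C (X (e (some j), s)) * map C (q (e (some j)) s)))
      fun x : ι × S => Polynomial.C (C (X x)))
  let χ : Polynomial A →+* Polynomial B := Polynomial.eval₂RingHom ψ Polynomial.X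
  have hχX : χ Polynomial.X = Polynomial.X := Polynomial.eval₂_X _ _
  have hχC : ∀ a, χ (Polynomial.C a) = ψ a := fun a => Polynomial.eval₂_C _ _
  obtain ⟨υk, hυkC, hυkX⟩ := exists_ringHom ((Polynomial.C.comp C).comp C : K →+* Polynomial B)
    fun x : ι × S => Polynomial.X * Polynomial.C (C (X x)) - Polynomial.C (C (C (δ x.1 x.2)))
  obtain ⟨υ, hυC, hυX⟩ := exists_ringHom υk fun j : τ => Polynomial.C (X j)
  have hυ : ∀ p : MvPolynomial τ K, υ (map C p) = Polynomial.C (map C p) := by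
    refine RingHom.congr_fun (f := υ.comp (map C))
      (g := Polynomial.C.comp (map (C : K →+* MvPolynomial (ι × S) K)))
      (ringHom_ext (fun a => ?_) fun j => ?_)
    · simp only [RingHom.comp_apply, map_C, hυC, hυkC]
    · simp only [RingHom.comp_apply, map_X, hυX]
  have hcomp : χ.comp ρ = (υ.comp (genericHom q).toRingHom).comp (rename
      (Sum.elim (fun j => (e (some j), none)) fun x => (x.1, some x.2)) : A →ₐ[K] _).toRingHom := by
    refine ringHom_ext (fun a => ?_) ?_
    · simp only [RingHom.comp_apply, AlgHom.toRingHom_eq_coe, RingHom.coe_coe, hρC, hχC, hψC,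
        rename_C, genericHom_C, hυC, hυkC]
    · rintro (j | x)
      · have h1 := congrArg (fun p => Polynomial.C (map (C : K →+* MvPolynomial (ι × S) K) p)) (hδ j)
        simp only [map_sum, map_mul, map_C, map_X] at h1
        simp only [AlgHom.toRingHom_eq_coe, RingHom.comp_apply, RingHom.coe_coe, hρX, hχC, hψX,
          rename_X, genericHom_X, Sum.elim_inl, Option.elim_none, map_neg, map_sum, map_mul, hυ,
          hυC, hυkX]
        exact add_mul_neg_sum_eq (A := Polynomial (MvPolynomial τ (MvPolynomial (ι × S) K)))
          Polynomial.X (fun s => Polynomial.C (C (X (e (some j), s))))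
          (fun s => Polynomial.C (map C (q (e (some j)) s)))
          (d := fun s => Polynomial.C (C (C (δ (e (some j)) s)))) h1
      · simp only [AlgHom.toRingHom_eq_coe, RingHom.comp_apply, RingHom.coe_coe, hρX, hχC, hψX,
          rename_X, genericHom_X, Sum.elim_inr, Option.elim_some, hυC, hυkX, map_mul, map_sub, hχX,
          hψC]
  let η : A →+* B := (sumAlgEquiv K τ (ι × S)).toAlgHom.toRingHom
  have hη : ∀ a, (χ (Polynomial.C a)).coeff 0 = η a := fun a => by
    rw [hχC]
    refine RingHom.congr_fun (f := (Polynomial.constantCoeff (R := B)).comp ψ) (g := η)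
      (ringHom_ext (fun a => ?_) ?_) a
    · rw [RingHom.comp_apply, hψC]
      simp [η]
    · rintro (j | x)
      · simp [hψX, η]
      · simp [hψX, η]
  obtain ⟨k, hk, hk0⟩ := exists_coeff_ne_zero_of_map_eq_zero χ hχX η hη
    (p := ρ a) (fun h => ha0 (by rw [← hρ a, h, Polynomial.eval₂_zero])) (by
      refine (RingHom.congr_fun hcomp a).trans ?_
      simp only [AlgHom.toRingHom_eq_coe, RingHom.comp_apply, RingHom.coe_coe, ha, map_zero])
  exact hk ((map_eq_zero_iff η (sumAlgEquiv K τ (ι × S)).injective).1 hk0)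

end Generic

section Resultant

variable {K ι τ S : Type*} [Field K] [Fintype S] [Fintype ι] [Fintype τ] [DecidableEq ι]
  {q : ι → S → MvPolynomial τ K} {b : ι → ℕ}

/-- The coordinates `(i, none)` other than `(e none, none)` and all coordinates `(i, some s)`,
with `(e none, none)` as the distinguished one. -/
def coordEquiv (e : Option τ ≃ ι) : Option (τ ⊕ ι × S) ≃ ι × Option S where
  toFun o := o.elim (e none, none)
    (Sum.elim (fun j => (e (some j), none)) fun x => (x.1, some x.2))
  invFun x := x.2.elim ((e.symm x.1).map Sum.inl) fun s => some (Sum.inr (x.1, s))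
  left_inv o := by rcases o with _ | j | x <;> simp
  right_inv x := by
    obtain ⟨i, _ | s⟩ := x
    · obtain ⟨_ | j, rfl⟩ := e.surjective i <;> simp
    · simp

theorem exists_generic_relation (e : Option τ ≃ ι) (hb : ∀ i, 1 ≤ b i)
    (hq : ∀ i s, q i s ∈ weightLE K 1 (b i)) (δ : ι → S → K)
    (hδ : ∀ j, ∑ s, C (δ (e (some j)) s) * q (e (some j)) s = X j) :
    ∃ R, R ≠ 0 ∧ genericHom q R = 0 ∧ ∀ i₀,
      R ∈ weightLE K (fun x : ι × Option S => if x.1 = i₀ then 1 else 0)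
        (∏ j ∈ Finset.univ.erase i₀, b j) := by
  have hcard : ∀ i₀ : ι, Fintype.card {i : ι // i ≠ i₀} = Fintype.card τ := fun i₀ => by
    have := Fintype.card_congr e
    rw [Fintype.card_option] at this
    simp [Fintype.card_subtype_compl, ← this]
  have hker : (RingHom.ker (genericHom q)).IsPrime := RingHom.ker_isPrime _
  have hne : RingHom.ker (genericHom q) ≠ ⊥ := fun h => by
    obtain ⟨D, hD0, hD, -⟩ := exists_generic_eliminant (e none) (hcard _) hb hq
    exact hD0 (by simpa [h] using (RingHom.mem_ker (f := genericHom q)).2 hD)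
  obtain ⟨R, hR, hRp⟩ := hker.exists_mem_prime_of_ne_bot hne
  refine ⟨R, hRp.ne_zero, hR, fun i₀ => ?_⟩
  obtain ⟨D, hD0, hD, hDw⟩ := exists_generic_eliminant i₀ (hcard i₀) hb hq
  refine mem_weightLE_of_dvd ?_ hD0 hDw
  exact MvPolynomial.dvd_of_prime_of_map_eq_zero (coordEquiv e) (genericHom q).toRingHom
    (fun a ha => genericHom_rename_injective e δ hδ ha) hRp hR hD

end Resultant

section Perron

variable {K ι τ ρ S : Type*} [Field K] [Fintype S] [Fintype ι] [Fintype τ] [DecidableEq ι]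
  {q : ι → S → MvPolynomial τ K} {a b : ι → ℕ}

theorem coeff_ringHom_mem_weightLE {σ σ' R R' : Type*} [CommRing R] [CommRing R']
    (F : MvPolynomial σ R →+* Polynomial (MvPolynomial σ' R')) {v : σ → ℕ} {w : σ' → ℕ} {d : ℕ}
    (hC : ∀ a k, (F (C a)).coeff k ∈ weightLE R' w 0)
    (hX : ∀ i k, (F (X i)).coeff k ∈ weightLE R' w (v i))
    {p : MvPolynomial σ R} (hp : p ∈ weightLE R v d) (k : ℕ) :
    (F p).coeff k ∈ weightLE R' w d := by
  rw [p.as_sum, map_sum, Polynomial.finsetSum_coeff]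
  refine Submodule.sum_mem _ fun m hm => weightLE_mono (mem_weightLE.1 hp m hm) ?_
  rw [monomial_eq, map_mul, Finsupp.prod, map_prod, ← zero_add (Finsupp.weight _ _),
    Finsupp.weight_apply]
  refine coeff_mul_mem_weightLE (hC _) (coeff_prod_mem_weightLE _ fun i _ => ?_) k
  rw [map_pow]
  exact coeff_pow_mem_weightLE (hX i) _

theorem mem_weightLE_comp {σ : Type*} (f : σ → ι) {B : ι → ℕ} {R : MvPolynomial σ K}
    (h : ∀ i, R ∈ weightLE K (fun x => if f x = i then 1 else 0) (B i)) :
    R ∈ weightLE K (fun x => a (f x)) (∑ i, a i * B i) := by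
  refine mem_weightLE.2 fun m hm => ?_
  have : Finsupp.weight (fun x => a (f x)) m =
      ∑ i, a i * Finsupp.weight (fun x => if f x = i then 1 else 0) m := by
    simp only [Finsupp.weight_apply, Finsupp.sum, Finset.mul_sum]
    rw [Finset.sum_comm]
    refine Finset.sum_congr rfl fun x _ => ?_
    simp [mul_comm]
  rw [this]
  exact Finset.sum_le_sum fun i _ => Nat.mul_le_mul_left _ (mem_weightLE.1 (h i) m hm)

theorem exists_eval_ne_zero {σ : Type*} [Infinite K] {R : MvPolynomial σ K} (hR : R ≠ 0) :
    ∃ v, eval v R ≠ 0 := by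
  by_contra! h
  exact hR (MvPolynomial.funext fun v => by rw [h, map_zero])

/-- Perron's theorem for polynomials with coefficients of bounded degree in parameters. -/
theorem exists_weighted_relation [Infinite K] (e : Option τ ≃ ι) (hb : ∀ i, 1 ≤ b i)
    (hq : ∀ i s, q i s ∈ weightLE K 1 (b i)) (δ : ι → S → K)
    (hδ : ∀ j, ∑ s, C (δ (e (some j)) s) * q (e (some j)) s = X j)
    (c : ι → S → MvPolynomial ρ K) (hc : ∀ i s, c i s ∈ weightLE K 1 (a i)) :
    ∃ Q : MvPolynomial (ρ ⊕ ι) K, Q ≠ 0 ∧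
      Q ∈ weightLE K (Sum.elim 1 a) (∑ i, a i * ∏ j ∈ Finset.univ.erase i, b j) ∧
      aeval (Sum.elim (fun j => X (Sum.inl j))
        fun i => ∑ s, rename Sum.inl (c i s) * rename Sum.inr (q i s)) Q =
          (0 : MvPolynomial (ρ ⊕ τ) K) := by
  obtain ⟨R, hR0, hR, hRw⟩ := exists_generic_relation e hb hq δ hδ
  obtain ⟨v, hv⟩ := exists_eval_ne_zero hR0
  let A := MvPolynomial (ρ ⊕ ι) K
  let B := MvPolynomial (ρ ⊕ τ) K
  let d : ι → S → K := fun i s => v (i, some s) - constantCoeff (c i s)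
  let u : ι × Option S → Polynomial A := fun x =>
    x.2.elim (Polynomial.X * Polynomial.C (C (v (x.1, none))) - Polynomial.C (X (Sum.inr x.1)))
      fun s => Polynomial.C (rename Sum.inl (c x.1 s)) + Polynomial.X * Polynomial.C (C (d x.1 s))
  obtain ⟨U, hUC, hUX⟩ := exists_ringHom (R := K) (R' := Polynomial A) (Polynomial.C.comp C) u
  let h : ι → B := fun i => ∑ s, rename Sum.inl (c i s) * rename Sum.inr (q i s)
  let w : ι → B := fun i => C (v (i, none)) + ∑ s, C (d i s) * rename Sum.inr (q i s)
  obtain ⟨ψ, hψC, hψX⟩ := exists_ringHom (σ := ρ ⊕ ι) (R := K) (R' := Polynomial B)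
    (Polynomial.C.comp C) (Sum.elim (fun j => Polynomial.C (X (Sum.inl j)))
      fun i => Polynomial.C (h i) + Polynomial.X * Polynomial.C (w i))
  have hψ : ∀ p : MvPolynomial ρ K, ψ (rename Sum.inl p) = Polynomial.C (rename Sum.inl p) := by
    refine RingHom.congr_fun (f := ψ.comp (rename Sum.inl : _ →ₐ[K] _).toRingHom)
      (g := Polynomial.C.comp (rename Sum.inl : _ →ₐ[K] _).toRingHom)
      (ringHom_ext (fun a => ?_) fun j => ?_)
    · simp only [AlgHom.toRingHom_eq_coe, RingHom.comp_apply, RingHom.coe_coe, rename_C, hψC]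
    · simp only [AlgHom.toRingHom_eq_coe, RingHom.comp_apply, RingHom.coe_coe, rename_X, hψX,
        Sum.elim_inl]
  let χ : Polynomial A →+* Polynomial B := Polynomial.eval₂RingHom ψ Polynomial.X
  have hχX : χ Polynomial.X = Polynomial.X := Polynomial.eval₂_X _ _
  have hχC : ∀ a, χ (Polynomial.C a) = ψ a := fun a => Polynomial.eval₂_C _ _
  obtain ⟨υk, hυkC, hυkX⟩ := exists_ringHom (σ := ι × S) (R := K) (R' := Polynomial B)
    (Polynomial.C.comp C) fun x => Polynomial.C (rename Sum.inl (c x.1 x.2)) +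
      Polynomial.X * Polynomial.C (C (d x.1 x.2))
  obtain ⟨υ, hυC, hυX⟩ := exists_ringHom υk fun j : τ => Polynomial.C (X (Sum.inr j))
  have hυ : ∀ p : MvPolynomial τ K, υ (map C p) = Polynomial.C (rename Sum.inr p) := by
    refine RingHom.congr_fun (f := υ.comp (map C))
      (g := Polynomial.C.comp (rename Sum.inr : _ →ₐ[K] _).toRingHom)
      (ringHom_ext (fun a => ?_) fun j => ?_)
    · simp only [AlgHom.toRingHom_eq_coe, RingHom.comp_apply, RingHom.coe_coe, map_C, rename_C,
        hυC, hυkC]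
    · simp only [AlgHom.toRingHom_eq_coe, RingHom.comp_apply, RingHom.coe_coe, map_X, rename_X,
        hυX]
  have hcomp : ∀ p, χ (U p) = υ (genericHom q p) := by
    refine RingHom.congr_fun (f := χ.comp U) (g := υ.comp (genericHom q).toRingHom)
      (ringHom_ext (fun a => ?_) fun x => ?_)
    · simp only [AlgHom.toRingHom_eq_coe, RingHom.comp_apply, RingHom.coe_coe, hUC, hχC, hψC,
        genericHom_C, hυC, hυkC]
    · obtain ⟨i, _ | s⟩ := x
      · simp only [AlgHom.toRingHom_eq_coe, RingHom.comp_apply, RingHom.coe_coe, hUX, u,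
          Option.elim_none, genericHom_X, map_sub, map_mul, hχX, hχC, hψC, hψX, Sum.elim_inr,
          map_neg, map_sum, hυC, hυkX, hυ, h, w, map_add, add_mul, Finset.sum_add_distrib,
          mul_assoc, ← Finset.mul_sum]
        ring
      · simp only [AlgHom.toRingHom_eq_coe, RingHom.comp_apply, RingHom.coe_coe, hUX, u,
          Option.elim_some, genericHom_X, map_add, map_mul, hχX, hχC, hψC, hψ, hυC, hυkX]
  have hU0 : U R ≠ 0 := fun h0 => hv <| by
    refine (RingHom.congr_fun (f := (Polynomial.eval₂RingHom (constantCoeff (R := K)) 1).comp U)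
      (g := eval v) (ringHom_ext (fun a => ?_) fun x => ?_) R).symm.trans ?_
    · simp only [RingHom.comp_apply, hUC, Polynomial.coe_eval₂RingHom, Polynomial.eval₂_C, eval_C]
      exact constantCoeff_C _ a
    · obtain ⟨i, _ | s⟩ := x
      · simp [hUX, u]
      · simp [hUX, u, d]
    · rw [RingHom.comp_apply, h0, map_zero]
  let η : A →+* B := (aeval (Sum.elim (fun j => X (Sum.inl j)) h) : A →ₐ[K] B).toRingHom
  have hη : ∀ p, (χ (Polynomial.C p)).coeff 0 = η p := fun p => by
    rw [hχC]
    refine RingHom.congr_fun (f := (Polynomial.constantCoeff (R := B)).comp ψ) (g := η)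
      (ringHom_ext (fun a => ?_) ?_) p
    · rw [RingHom.comp_apply, hψC]
      simp only [RingHom.comp_apply, Polynomial.constantCoeff_apply, Polynomial.coeff_C_zero]
      exact (aeval_C _ a).symm
    · rintro (j | i) <;> simp [hψX, η]
  obtain ⟨k, hk, hk0⟩ := exists_coeff_ne_zero_of_map_eq_zero χ hχX η hη hU0
    (by rw [hcomp, hR, map_zero])
  refine ⟨_, hk, ?_, hk0⟩
  refine coeff_ringHom_mem_weightLE U (v := fun x => a x.1) (fun c k => ?_) (fun x k => ?_)
    (mem_weightLE_comp Prod.fst hRw) k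
  · rw [hUC, RingHom.comp_apply, Polynomial.coeff_C]
    split_ifs
    · exact C_mem_weightLE _
    · exact zero_mem _
  · have hX1 : ∀ (c : K) (d : ℕ), (Polynomial.X * Polynomial.C (C c) : Polynomial A).coeff k ∈
        weightLE K (Sum.elim 1 a) d := fun c d => by
      rw [Polynomial.coeff_mul_C, Polynomial.coeff_X]
      split_ifs
      · rw [one_mul]
        exact C_mem_weightLE _
      · simp
    have hC1 : ∀ (p : A) (d : ℕ), p ∈ weightLE K (Sum.elim 1 a) d →
        (Polynomial.C p).coeff k ∈ weightLE K (Sum.elim 1 a) d := fun p d hp => by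
      rw [Polynomial.coeff_C]
      split_ifs
      · exact hp
      · exact zero_mem _
    rw [hUX]
    obtain ⟨i, _ | s⟩ := x
    · simp only [u, Option.elim_none, Polynomial.coeff_sub]
      exact sub_mem (hX1 _ _) (hC1 _ _ (X_mem_weightLE le_rfl))
    · simp only [u, Option.elim_some, Polynomial.coeff_add]
      exact add_mem (hC1 _ _ (rename_mem_weightLE (hc i s))) (hX1 _ _)

end Perron

theorem Finsupp.weight_mapDomain' {σ τ : Type*} (w : τ → ℕ) (f : σ → τ) (m : σ →₀ ℕ) :
    Finsupp.weight w (m.mapDomain f) = Finsupp.weight (w ∘ f) m := by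
  simp only [Finsupp.weight_apply]
  exact Finsupp.sum_mapDomain_index (by simp) (by intros; simp [add_mul])

section Bidegree

variable {K ι τ ρ : Type*} [Field K] {a b : ι → ℕ}

theorem mapDomain_fst_add_mapDomain_snd (M : ρ ⊕ τ →₀ ℕ) :
    (Finsupp.sumFinsuppEquivProdFinsupp M).1.mapDomain Sum.inl +
      (Finsupp.sumFinsuppEquivProdFinsupp M).2.mapDomain Sum.inr = M := by
  ext (j | i)
  · rw [Finsupp.add_apply, Finsupp.mapDomain_apply Sum.inl_injective,
      Finsupp.mapDomain_of_notMem_range _ _ (by simp)]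
    simp
  · rw [Finsupp.add_apply, Finsupp.mapDomain_apply Sum.inr_injective,
      Finsupp.mapDomain_of_notMem_range _ _ (by simp)]
    simp

theorem weight_elim (w₁ : ρ → ℕ) (w₂ : τ → ℕ) (M : ρ ⊕ τ →₀ ℕ) :
    Finsupp.weight (Sum.elim w₁ w₂) M =
      Finsupp.weight w₁ (Finsupp.sumFinsuppEquivProdFinsupp M).1 +
        Finsupp.weight w₂ (Finsupp.sumFinsuppEquivProdFinsupp M).2 := by
  conv_lhs => rw [← mapDomain_fst_add_mapDomain_snd M]
  rw [map_add, Finsupp.weight_mapDomain', Finsupp.weight_mapDomain', Sum.elim_comp_inl,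
    Sum.elim_comp_inr]

theorem exists_bidegree_relation [Infinite K] [Fintype ι] [Fintype τ] [DecidableEq ι]
    (e : Option τ ≃ ι) (hb : ∀ i, 1 ≤ b i)
    {h : ι → MvPolynomial (ρ ⊕ τ) K} (hha : ∀ i, h i ∈ weightLE K (Sum.elim 1 0) (a i))
    (hhb : ∀ i, h i ∈ weightLE K (Sum.elim 0 1) (b i)) :
    ∃ Q : MvPolynomial (ρ ⊕ ι) K, Q ≠ 0 ∧
      Q ∈ weightLE K (Sum.elim 1 a) (∑ i, a i * ∏ j ∈ Finset.univ.erase i, b j) ∧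
      aeval (Sum.elim (fun j => X (Sum.inl j)) h) Q = (0 : MvPolynomial (ρ ⊕ τ) K) := by
  classical
  let F : (ρ ⊕ τ →₀ ℕ) → (ρ →₀ ℕ) × (τ →₀ ℕ) := Finsupp.sumFinsuppEquivProdFinsupp
  let T : Finset (τ →₀ ℕ) := (Finset.univ.biUnion fun i => (h i).support.image fun M => (F M).2) ∪
    Finset.univ.image fun j => Finsupp.single j 1
  let q : ι → T → MvPolynomial τ K := fun i s =>
    if Finsupp.weight 1 (s : τ →₀ ℕ) ≤ b i then monomial s 1 else 0
  let c : ι → T → MvPolynomial ρ K := fun i s =>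
    ∑ M ∈ (h i).support with (F M).2 = s, monomial (F M).1 ((h i).coeff M)
  let δ : ι → T → K := fun i s =>
    (e.symm i).elim 0 fun j => if (s : τ →₀ ℕ) = Finsupp.single j 1 then 1 else 0
  have hq : ∀ i s, q i s ∈ weightLE K 1 (b i) := fun i s => by
    simp only [q]
    split_ifs with hs
    · exact monomial_mem_weightLE hs 1
    · exact zero_mem _
  have hc : ∀ i s, c i s ∈ weightLE K 1 (a i) := fun i s =>
    Submodule.sum_mem _ fun M hM => monomial_mem_weightLE (by
      have := mem_weightLE.1 (hha i) M (Finset.mem_filter.1 hM).1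
      rw [weight_elim] at this
      exact (Nat.le_add_right _ _).trans this) _
  have hδ : ∀ j, ∑ s, C (δ (e (some j)) s) * q (e (some j)) s = X j := fun j => by
    rw [Finset.sum_eq_single ⟨Finsupp.single j 1, by simp [T]⟩]
    · simp [δ, q, Finsupp.weight_single, hb, X]
    · intro s _ hs
      have : (s : τ →₀ ℕ) ≠ Finsupp.single j 1 := fun h => hs (Subtype.ext h)
      simp [δ, this]
    · simp
  have hh : ∀ i, ∑ s, rename Sum.inl (c i s) * rename Sum.inr (q i s) = h i := fun i => by
    have h1 : ∀ s : T, rename Sum.inl (c i s) * rename Sum.inr (q i s) =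
        ∑ M ∈ (h i).support with (F M).2 = s, monomial M ((h i).coeff M) := fun s => by
      rw [map_sum, Finset.sum_mul]
      refine Finset.sum_congr rfl fun M hM => ?_
      obtain ⟨hM, hs⟩ := Finset.mem_filter.1 hM
      have := mem_weightLE.1 (hhb i) M hM
      rw [weight_elim] at this
      have hw : Finsupp.weight 1 (s : τ →₀ ℕ) ≤ b i := by
        rw [← hs]
        exact (Nat.le_add_left _ _).trans this
      simp only [q, if_pos hw, rename_monomial, monomial_mul, mul_one, ← hs]
      rw [mapDomain_fst_add_mapDomain_snd]
    simp only [h1]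
    conv_rhs => rw [(h i).as_sum]
    rw [Finset.sum_coe_sort T fun s => ∑ M ∈ (h i).support with (F M).2 = s,
      monomial M ((h i).coeff M)]
    refine Finset.sum_fiberwise_of_maps_to (fun M hM => ?_) _
    exact Finset.mem_union_left _ (Finset.mem_biUnion.2 ⟨i, Finset.mem_univ _,
      Finset.mem_image_of_mem _ hM⟩)
  obtain ⟨Q, hQ0, hQ, hQz⟩ := exists_weighted_relation e hb hq δ hδ c hc
  simp only [hh] at hQz
  exact ⟨Q, hQ0, hQ, hQz⟩

end Bidegree

theorem prime_rename_of_injective {σ τ R : Type*} [CommRing R] {f : σ → τ}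
    (hf : Function.Injective f) {p : MvPolynomial σ R} (hp : Prime p) : Prime (rename f p) := by
  have h : rename f p =
      rename Subtype.val (renameEquiv R (Equiv.ofInjective f hf) p) := by
    rw [renameEquiv_apply, rename_rename]
    rfl
  rw [h, prime_rename_iff]
  exact (MulEquiv.prime_iff (renameEquiv R (Equiv.ofInjective f hf)).toMulEquiv).2 hp

/-- An algebraically independent family of polynomials is completed to a transcendence basis by
some of the variables. -/
theorem exists_algebraicIndependent_sumElim_X {K σ κ : Type*} [Field K] [Fintype σ] [Fintype κ]
    {v : κ → MvPolynomial σ K} (hv : AlgebraicIndependent K v) :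
    ∃ J : Finset σ, AlgebraicIndependent K (Sum.elim v fun i : J => X (i : σ)) ∧
      Fintype.card κ + J.card = Fintype.card σ := by
  classical
  let s : Set (MvPolynomial σ K) := Set.range v
  let t : Set (MvPolynomial σ K) := s ∪ Set.range X
  have ht : Algebra.adjoin K t = ⊤ := by
    rw [eq_top_iff, ← adjoin_range_X]
    exact Algebra.adjoin_mono Set.subset_union_right
  have : Algebra.IsAlgebraic (Algebra.adjoin K t) (MvPolynomial σ K) :=
    ⟨fun x => isAlgebraic_algebraMap (⟨x, ht ▸ trivial⟩ : Algebra.adjoin K t)⟩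
  obtain ⟨u, hsu, hut, hu⟩ := exists_isTranscendenceBasis_between s t Set.subset_union_left
    hv.coe_range
  let J : Finset σ := {i | X i ∈ u ∧ X i ∉ s}
  let g : κ ⊕ J → u := Sum.elim (fun k => ⟨v k, hsu ⟨k, rfl⟩⟩)
    fun i => ⟨X (i : σ), (Finset.mem_filter.1 i.2).2.1⟩
  have hg : Function.Bijective g := by
    constructor
    · rintro (k | i) (k' | i') h <;> replace h := congrArg Subtype.val h
      · rw [hv.injective h]
      · exact ((Finset.mem_filter.1 i'.2).2.2 ⟨k, h⟩).elim
      · exact ((Finset.mem_filter.1 i.2).2.2 ⟨k', h.symm⟩).elim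
      · rw [Subtype.ext (X_injective h)]
    · rintro ⟨x, hx⟩
      by_cases hxs : x ∈ s
      · obtain ⟨k, rfl⟩ := hxs
        exact ⟨Sum.inl k, rfl⟩
      · obtain ⟨i, rfl⟩ := (hut hx).resolve_left hxs
        exact ⟨Sum.inr ⟨i, by simp [J, hx, hxs]⟩, rfl⟩
  refine ⟨J, ?_, ?_⟩
  · convert hu.1.comp g hg.1 using 1
    ext1 (k | i) <;> rfl
  · have h1 := hu.lift_cardinalMk_eq (IsTranscendenceBasis.mvPolynomial σ K)
    have : Finite u := Finite.of_surjective g hg.2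
    have := Fintype.ofFinite u
    have h3 := Fintype.card_congr (Equiv.ofBijective g hg)
    simp only [Cardinal.mk_fintype, Cardinal.lift_natCast, Nat.cast_inj] at h1
    rw [← h1, ← h3, Fintype.card_sum, Fintype.card_coe]

section Final

variable {K : Type*} [Field K] {r n : ℕ}

theorem mem_weightLE_degMu (p : MvPolynomial (Fin r ⊕ Fin n) K) :
    p ∈ weightLE K (Sum.elim 1 0) (degMu p) :=
  mem_weightLE.2 fun m hm => by
    rw [Finsupp.weight_eq_sum, Fintype.sum_sum_type]
    simpa [degMu] using Finset.le_sup (f := fun m : Fin r ⊕ Fin n →₀ ℕ => ∑ j, m (Sum.inl j)) hm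

theorem mem_weightLE_degXv (p : MvPolynomial (Fin r ⊕ Fin n) K) :
    p ∈ weightLE K (Sum.elim 0 1) (degXv p) :=
  mem_weightLE.2 fun m hm => by
    rw [Finsupp.weight_eq_sum, Fintype.sum_sum_type]
    simpa [degXv] using Finset.le_sup (f := fun m : Fin r ⊕ Fin n →₀ ℕ => ∑ j, m (Sum.inr j)) hm

theorem algebraicIndependent_of_ker_liePhi [CharZero K] (f : MvPolynomial (Fin r ⊕ Fin n) K)
    (L : Derivation ℚ (MvPolynomial (Fin r ⊕ Fin n) K) (MvPolynomial (Fin r ⊕ Fin n) K)) (ν : ℕ)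
    (hinj : ∀ ν' < ν, RingHom.ker (liePhi f L ν') = ⊥) :
    AlgebraicIndependent K (Sum.elim (fun j => X (Sum.inl j)) fun k : Fin ν => (⇑L)^[(k : ℕ)] f :
      Fin r ⊕ Fin ν → MvPolynomial (Fin r ⊕ Fin n) K) := by
  cases ν with
  | zero =>
    have h : Function.Injective (Sum.elim Sum.inl fun k : Fin 0 => k.elim0 :
        Fin r ⊕ Fin 0 → Fin r ⊕ Fin n) := by
      rintro (j | k) (j' | k') h
      · simpa using h
      all_goals first | exact k.elim0 | exact k'.elim0
    convert (algebraicIndependent_X (Fin r ⊕ Fin n) K).comp _ h using 1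
    ext1 (j | k)
    · rfl
    · exact k.elim0
  | succ ν =>
    rw [algebraicIndependent_iff_injective_aeval]
    exact (RingHom.injective_iff_ker_eq_bot (liePhi f L ν)).2 (hinj ν ν.lt_succ_self)

/-- All variables, with `y_ν` as the distinguished one. -/
noncomputable def lastEquiv (r ν : ℕ) (J : Type*) :
    Option ((Fin r ⊕ Fin ν) ⊕ J) ≃ Fin r ⊕ (Fin (ν + 1) ⊕ J) :=
  Equiv.ofBijective (fun o => o.elim (Sum.inr (Sum.inl (Fin.last ν)))
    (Sum.elim (Sum.elim Sum.inl fun k => Sum.inr (Sum.inl k.castSucc)) fun j => Sum.inr (Sum.inr j)))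
    ⟨by
      rintro (_ | (j | k) | i) (_ | (j' | k') | i') h <;>
        simp_all [Fin.ext_iff, Nat.ne_of_lt, Nat.ne_of_gt], by
      rintro (j | k | i)
      · exact ⟨some (Sum.inl (Sum.inl j)), rfl⟩
      · induction k using Fin.lastCases with
        | last => exact ⟨none, rfl⟩
        | cast k => exact ⟨some (Sum.inl (Sum.inr k)), rfl⟩
      · exact ⟨some (Sum.inr i), rfl⟩⟩

end Final

theorem stmt0 {K : Type*} [Field K] [CharZero K] {r n : ℕ} (hn : 1 ≤ n)
    (g : Fin n → MvPolynomial (Fin r ⊕ Fin n) K) (f : MvPolynomial (Fin r ⊕ Fin n) K)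
    (L : Derivation ℚ (MvPolynomial (Fin r ⊕ Fin n) K) (MvPolynomial (Fin r ⊕ Fin n) K))
    (hLx : ∀ i, L (X (Sum.inr i)) = g i)
    (hLmu : ∀ j, L (X (Sum.inl j)) = 0)
    (hLC : ∀ c : K, ∃ c' : K, L (C c) = C c')
    (dmu dx Dmu Dx : ℕ)
    (hdmu : dmu = degMu f) (hdx : dx = degXv f)
    (hDmu : Dmu = Finset.univ.sup fun i => degMu (g i))
    (hDx : Dx = Finset.univ.sup fun i => degXv (g i))
    (hdx1 : 1 ≤ dx) (hDx1 : 1 ≤ Dx)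
    (ν : ℕ)
    (hinj : ∀ ν' < ν, RingHom.ker (liePhi f L ν') = ⊥)
    (P : MvPolynomial (Fin r ⊕ Fin (ν + 1)) K) (hP0 : P ≠ 0)
    (hPgen : RingHom.ker (liePhi f L ν) = Ideal.span {P}) :
    ∀ m ∈ P.support,
      (∑ j : Fin r, m (Sum.inl j)) +
          (∑ i : Fin (ν + 1), (dmu + (i : ℕ) * Dmu) * m (Sum.inr i)) ≤
        ∑ i : Fin (ν + 1), (dmu + (i : ℕ) * Dmu) *
          ∏ j ∈ Finset.univ.erase i, (dx + (j : ℕ) * (Dx - 1)) := by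
  let h : ℕ → MvPolynomial (Fin r ⊕ Fin n) K := fun k => (⇑L)^[k] f
  have hLmuw : ∀ k, h k ∈ weightLE K (Sum.elim 1 0) (dmu + k * Dmu) := fun k => by
    refine iterate_derivation_mem_weightLE L ?_ hLC (hdmu ▸ mem_weightLE_degMu f) k
    rintro (j | i)
    · rw [hLmu]
      exact zero_mem _
    · rw [hLx, Sum.elim_inr, Pi.zero_apply, zero_add, hDmu]
      exact weightLE_mono (Finset.le_sup (f := fun i => degMu (g i)) (Finset.mem_univ i))
        (mem_weightLE_degMu (g i))
  have hLxw : ∀ k, h k ∈ weightLE K (Sum.elim 0 1) (dx + k * (Dx - 1)) := fun k => by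
    refine iterate_derivation_mem_weightLE L ?_ hLC (hdx ▸ mem_weightLE_degXv f) k
    rintro (j | i)
    · rw [hLmu]
      exact zero_mem _
    · rw [hLx, Sum.elim_inr, Pi.one_apply, Nat.add_sub_cancel' hDx1, hDx]
      exact weightLE_mono (Finset.le_sup (f := fun i => degXv (g i)) (Finset.mem_univ i))
        (mem_weightLE_degXv (g i))
  obtain ⟨J, hJ, hcard⟩ := exists_algebraicIndependent_sumElim_X
    (algebraicIndependent_of_ker_liePhi f L ν hinj)
  have hcard' : Fintype.card (Option (Fin n)) = Fintype.card (Fin (ν + 1) ⊕ J) := by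
    simp only [Fintype.card_sum, Fintype.card_fin, Fintype.card_option, Fintype.card_coe] at hcard ⊢
    omega
  let H : Fin (ν + 1) ⊕ J → MvPolynomial (Fin r ⊕ Fin n) K :=
    Sum.elim (fun k => h k) fun i => X (i : Fin r ⊕ Fin n)
  let a : Fin (ν + 1) ⊕ J → ℕ := Sum.elim (fun k => dmu + k * Dmu) 0
  let b : Fin (ν + 1) ⊕ J → ℕ := Sum.elim (fun k => dx + k * (Dx - 1)) 1
  obtain ⟨Q, hQ0, hQw, hQz⟩ := exists_bidegree_relation (Fintype.equivOfCardEq hcard')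
    (a := a) (b := b) (h := H) (by
      rintro (k | i)
      · exact hdx1.trans (Nat.le_add_right _ _)
      · exact le_rfl) (by
      rintro (k | ⟨i | i, hi⟩)
      · exact hLmuw k
      · exact absurd (hJ.injective (a₁ := Sum.inl (Sum.inl i)) (a₂ := Sum.inr ⟨Sum.inl i, hi⟩) rfl)
          (by simp)
      · exact X_mem_weightLE le_rfl) (by
      rintro (k | ⟨i | i, hi⟩)
      · exact hLxw k
      · exact X_mem_weightLE (Nat.zero_le _)
      · exact X_mem_weightLE le_rfl)
  let ι : Fin r ⊕ Fin (ν + 1) → Fin r ⊕ (Fin (ν + 1) ⊕ J) := Sum.map id Sum.inl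
  have hι : Function.Injective ι := Function.injective_id.sumMap Sum.inl_injective
  let Φ : MvPolynomial (Fin r ⊕ (Fin (ν + 1) ⊕ J)) K →ₐ[K] MvPolynomial (Fin r ⊕ Fin n) K :=
    aeval (Sum.elim (fun j => X (Sum.inl j)) H)
  have hPφ : liePhi f L ν P = 0 := by
    rw [← RingHom.mem_ker, hPgen]
    exact Ideal.mem_span_singleton_self P
  have hPprime : Prime P := (Ideal.span_singleton_prime hP0).1 (hPgen ▸ RingHom.ker_isPrime _)
  have hdvd : rename ι P ∣ Q := by
    refine MvPolynomial.dvd_of_prime_of_map_eq_zero (lastEquiv r ν J) Φ.toRingHom (fun p hp => ?_)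
      (prime_rename_of_injective hι hPprime) ?_ hQz
    · refine (injective_iff_map_eq_zero _).1 (algebraicIndependent_iff_injective_aeval.1 hJ) p ?_
      refine Eq.trans ?_ ((aeval_rename _ _ _).symm.trans hp)
      congr 2
      ext1 ((j | k) | i) <;> rfl
    · refine (aeval_rename _ _ _).trans (Eq.trans ?_ hPφ)
      rw [liePhi]
      congr 2
      ext1 (j | k) <;> rfl
  intro m hm
  have hm' : m.mapDomain ι ∈ (rename ι P).support := by
    rw [mem_support_iff, coeff_rename_mapDomain ι hι]
    exact mem_support_iff.1 hm
  have hprod : ∀ k : Fin (ν + 1), ∏ j ∈ Finset.univ.erase (Sum.inl k), b j =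
      ∏ j ∈ Finset.univ.erase k, (dx + (j : ℕ) * (Dx - 1)) := fun k => by
    refine Eq.trans ?_ (Finset.prod_map (Finset.univ.erase k) Function.Embedding.inl b)
    refine (Finset.prod_subset (fun j hj => ?_) fun j hj hj' => ?_).symm
    · obtain ⟨l, hl, rfl⟩ := Finset.mem_map.1 hj
      simpa using hl
    · rcases j with l | i
      · exact absurd (Finset.mem_map_of_mem Function.Embedding.inl (by simpa using hj)) hj'
      · rfl
  have hsum : ∑ i : Fin (ν + 1) ⊕ J, a i * ∏ j ∈ Finset.univ.erase i, b j =
      ∑ i : Fin (ν + 1), (dmu + (i : ℕ) * Dmu) *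
        ∏ j ∈ Finset.univ.erase i, (dx + (j : ℕ) * (Dx - 1)) := by
    rw [Fintype.sum_sum_type]
    simp [hprod, a]
  have hweight := mem_weightLE.1 (mem_weightLE_of_dvd hdvd hQ0 hQw) _ hm'
  rw [Finsupp.weight_mapDomain', Finsupp.weight_eq_sum, Fintype.sum_sum_type, hsum] at hweight
  simpa [ι, a, mul_comm] using hweight
end

section
/- Assume d_x ≥ 1 and D_x ≥ 1. Suppose ν ∈ ℕ is such that ker φ_{ν'} = 0 for every ν' < ν, and ker φ_ν is the principal ideal generated by a nonzero polynomial P ∈ K[μ_1,…,μ_r, y_0,…,y_ν] (this P is the minimal polynomial of the differential elimination ideal of the system x' = g(μ,x), y = f(μ,x)). Then for every monomial μ_1^{ℓ_1}···μ_r^{ℓ_r} y_0^{e_0}···y_ν^{e_ν} occurring in P one has ℓ_1 + ⋯ + ℓ_r + Σ_{i=0}^{ν} (d_x + i·(D_x − 1))·e_i ≤ Π_{i=0}^{ν} (d_x + d_μ + i·(D_x + D_μ − 1)). -/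
open MvPolynomial

theorem Nat.mul_choose_add_choose_le (m A d : ℕ) :
    d * (A + m).choose m + (A + m).choose (m + 1) ≤ (A + d + m).choose (m + 1) := by
  induction d with
  | zero => simp
  | succ d ih =>
    have h1 : (A + (d + 1) + m).choose (m + 1)
        = (A + d + m).choose m + (A + d + m).choose (m + 1) := by
      rw [show A + (d + 1) + m = (A + d + m) + 1 by ring, Nat.choose_succ_succ]
    have h2 : (A + m).choose m ≤ (A + d + m).choose m := Nat.choose_le_choose m (by omega)
    rw [h1, add_mul]
    omega

theorem Nat.le_of_forall_mul_pow_le {d W c s : ℕ}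
    (h : ∀ k : ℕ, d * (k * d) ^ s ≤ W * (k * d + c) ^ s) : d ≤ W := by
  rcases Nat.eq_zero_or_pos d with rfl | hd
  · exact Nat.zero_le _
  have hd' : (0 : ℝ) < d := by exact_mod_cast hd
  have hlim : Filter.Tendsto (fun k : ℕ => (W : ℝ) * (1 + ((c : ℝ) / d) / k) ^ s) Filter.atTop
      (nhds ((W : ℝ) * (1 + 0) ^ s)) :=
    (((tendsto_const_div_atTop_nhds_zero_nat ((c : ℝ) / d)).const_add 1).pow s).const_mul _
  have key : (d : ℝ) ≤ (W : ℝ) * (1 + 0) ^ s := by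
    refine ge_of_tendsto hlim ?_
    filter_upwards [Filter.eventually_ge_atTop 1] with k hk
    have hk' : (0 : ℝ) < k := by exact_mod_cast hk
    have hpos : (0 : ℝ) < ((k : ℝ) * d) ^ s := by positivity
    have hkd : (d : ℝ) * (k * d) ^ s ≤ W * (k * d + c) ^ s := by exact_mod_cast h k
    have hfac : (1 + ((c : ℝ) / d) / k) * (k * d) = k * d + c := by field_simp
    rw [← hfac, mul_pow (1 + _), ← mul_assoc] at hkd
    exact le_of_mul_le_mul_right hkd hpos
  have : (d : ℝ) ≤ W := by simpa using key
  exact_mod_cast this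

/-- A function on `ℕ` which grows like the counting function of a weighted simplex of normalised
volume `1 / W` cannot have increments over steps of length `d > W` bounded by the corresponding
binomial coefficients. -/
theorem Nat.le_of_choose_growth {m d W : ℕ} (N : ℕ → ℕ) (h0 : N 0 ≤ 1)
    (hlow : ∀ D, (D + (m + 1)).choose (m + 1) ≤ W * N D)
    (hstep : ∀ D, N (D + d) ≤ N D + (D + d + m).choose m) : d ≤ W := by
  have hup : ∀ k, d * N (k * d) ≤ ((k + 1) * d + m).choose (m + 1) := by
    intro k
    induction k with
    | zero =>
      have := Nat.mul_choose_add_choose_le m 0 d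
      simp only [zero_add, Nat.choose_self, mul_one] at this
      simp only [zero_mul, zero_add, one_mul]
      nlinarith
    | succ k ih =>
      have h1 := hstep (k * d)
      have h2 := Nat.mul_choose_add_choose_le m ((k + 1) * d) d
      have e1 : k * d + d = (k + 1) * d := by ring
      have e2 : (k + 1) * d + d = (k + 1 + 1) * d := by ring
      rw [e1] at h1
      rw [e2] at h2
      nlinarith
  refine Nat.le_of_forall_mul_pow_le (c := d + m) (s := m + 1) fun k => ?_
  have h1 : d * (k * d + (m + 1)).choose (m + 1) ≤ W * ((k + 1) * d + m).choose (m + 1) := by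
    nlinarith [hlow (k * d), hup k]
  have h2 : (k * d) ^ (m + 1) ≤ (k * d + (m + 1)).descFactorial (m + 1) := by
    refine le_trans (Nat.pow_le_pow_left ?_ _) (Nat.pow_sub_le_descFactorial _ _)
    omega
  have h3 : ((k + 1) * d + m).descFactorial (m + 1) ≤ (k * d + (d + m)) ^ (m + 1) := by
    refine (Nat.descFactorial_le_pow _ _).trans (le_of_eq ?_)
    ring
  rw [Nat.descFactorial_eq_factorial_mul_choose] at h2 h3
  calc d * (k * d) ^ (m + 1) ≤ d * ((m + 1).factorial * (k * d + (m + 1)).choose (m + 1)) := by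
        gcongr
    _ = (m + 1).factorial * (d * (k * d + (m + 1)).choose (m + 1)) := by ring
    _ ≤ (m + 1).factorial * (W * ((k + 1) * d + m).choose (m + 1)) := by gcongr
    _ = W * ((m + 1).factorial * ((k + 1) * d + m).choose (m + 1)) := by ring
    _ ≤ W * (k * d + (d + m)) ^ (m + 1) := by gcongr

theorem Finsupp.finite_setOf_sum_mul_le {σ : Type*} [Fintype σ] {w : σ → ℕ} (hw : ∀ i, 1 ≤ w i)
    (D : ℕ) : {a : σ →₀ ℕ | ∑ i, w i * a i ≤ D}.Finite := by
  refine (Finsupp.finite_of_nat_weight_le w (fun i => by have := hw i; omega) D).subset ?_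
  intro a ha
  simpa [Finsupp.weight_apply, Finsupp.sum_fintype, mul_comm] using ha

theorem Finsupp.card_setOf_sum_le {σ : Type*} [Fintype σ] (D : ℕ) :
    Nat.card {a : σ →₀ ℕ | ∑ i, a i ≤ D} = (D + Fintype.card σ).choose (Fintype.card σ) := by
  classical
  let e : {a : σ →₀ ℕ | ∑ i, a i ≤ D} ≃ (Finset.univ : Finset (Option σ)).finsuppAntidiag D :=
    { toFun := fun a => ⟨a.1.optionElim (D - ∑ i, a.1 i), by
        have ha : ∑ i, a.1 i ≤ D := a.2
        simp [Finset.mem_finsuppAntidiag, Fintype.sum_option, ha]⟩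
      invFun := fun b => ⟨b.1.some, by
        have hb := (Finset.mem_finsuppAntidiag.1 b.2).1
        rw [Fintype.sum_option] at hb
        simp only [Set.mem_ofPred_eq, Finsupp.some_apply]
        omega⟩
      left_inv := fun a => by
        ext i
        simp
      right_inv := fun b => by
        have hb := (Finset.mem_finsuppAntidiag.1 b.2).1
        rw [Fintype.sum_option] at hb
        ext (_ | i)
        · simp only [Finsupp.optionElim_apply_none, Finsupp.some_apply]
          omega
        · simp }
  rw [Nat.card_congr e, Nat.card_eq_finsetCard, Finset.card_finsuppAntidiag_nat_eq_choose,
    Finset.card_univ, Fintype.card_option,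
    show Fintype.card σ + 1 + D - 1 = D + Fintype.card σ by omega,
    Nat.choose_symm_add]

theorem Finsupp.choose_le_prod_mul_card {σ : Type*} [Fintype σ] {w : σ → ℕ} (hw : ∀ i, 1 ≤ w i)
    (D : ℕ) : (D + Fintype.card σ).choose (Fintype.card σ)
      ≤ (∏ i, w i) * Nat.card {a : σ →₀ ℕ | ∑ i, w i * a i ≤ D} := by
  classical
  have : Finite {a : σ →₀ ℕ | ∑ i, w i * a i ≤ D} := (Finsupp.finite_setOf_sum_mul_le hw D).to_subtype
  have e : (∏ i, w i) = Nat.card (∀ i, Fin (w i)) := by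
    simp
  rw [← Finsupp.card_setOf_sum_le, e, ← Nat.card_prod]
  let F : {b : σ →₀ ℕ | ∑ i, b i ≤ D} →
      (∀ i, Fin (w i)) × {a : σ →₀ ℕ | ∑ i, w i * a i ≤ D} := fun b =>
    (fun i => ⟨b.1 i % w i, Nat.mod_lt _ (hw i)⟩,
      ⟨Finsupp.equivFunOnFinite.symm fun i => b.1 i / w i, by
        have hb : ∑ i, b.1 i ≤ D := b.2
        exact (Finset.sum_le_sum fun i _ => Nat.mul_div_le (b.1 i) (w i)).trans hb⟩)
  refine Nat.card_le_card_of_injective F fun b c hbc => ?_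
  ext i
  have h1 := congrArg Fin.val (congrFun (congrArg Prod.fst hbc) i)
  have h2 := DFunLike.congr_fun (congrArg Subtype.val (congrArg Prod.snd hbc)) i
  simp only [F, Finsupp.equivFunOnFinite_symm_apply_apply] at h1 h2
  rw [← Nat.mod_add_div (b.1 i) (w i), ← Nat.mod_add_div (c.1 i) (w i), h1]
  erw [h2]

namespace MvPolynomial

section WeightGrading

variable {K σ : Type*} [CommRing K] [Fintype σ]

/-- The algebra map `X i ↦ X i * T ^ w i`, which records weights in the exponents of `T`. -/
noncomputable def weightGrading (w : σ → ℕ) :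
    MvPolynomial σ K →ₐ[K] Polynomial (MvPolynomial σ K) :=
  aeval fun i => Polynomial.C (X i) * Polynomial.X ^ w i

theorem weightGrading_monomial (w : σ → ℕ) (a : σ →₀ ℕ) (c : K) :
    weightGrading w (monomial a c) = Polynomial.monomial (∑ i, w i * a i) (monomial a c) := by
  rw [weightGrading, aeval_monomial, Finsupp.prod_fintype _ _ (by simp)]
  simp_rw [mul_pow, ← pow_mul, Finset.prod_mul_distrib, Finset.prod_pow_eq_pow_sum]
  rw [← Polynomial.C_mul_X_pow_eq_monomial, ← mul_assoc, monomial_eq,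
    Finsupp.prod_fintype _ _ (by simp)]
  simp [IsScalarTower.algebraMap_apply K (MvPolynomial σ K) (Polynomial (MvPolynomial σ K)),
    algebraMap_eq]

theorem coeff_coeff_weightGrading (w : σ → ℕ) (p : MvPolynomial σ K) (k : ℕ) (a : σ →₀ ℕ) :
    coeff a ((weightGrading w p).coeff k) = if ∑ i, w i * a i = k then coeff a p else 0 := by
  classical
  induction p using MvPolynomial.induction_on' with
  | monomial b c =>
    rw [weightGrading_monomial, Polynomial.coeff_monomial]
    by_cases hab : b = a
    · subst hab
      split_ifs <;> simp
    · split_ifs <;> simp [coeff_monomial, hab]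
  | add p q hp hq =>
    rw [map_add, Polynomial.coeff_add, coeff_add, hp, hq, coeff_add]
    split_ifs <;> simp

theorem weightGrading_ne_zero (w : σ → ℕ) {p : MvPolynomial σ K} (hp : p ≠ 0) :
    weightGrading w p ≠ 0 := by
  obtain ⟨a, ha⟩ := ne_zero_iff.1 hp
  intro h
  have := coeff_coeff_weightGrading w p (∑ i, w i * a i) a
  rw [h, if_pos rfl] at this
  simp at this
  exact ha this.symm

theorem natDegree_weightGrading_le_iff (w : σ → ℕ) (p : MvPolynomial σ K) (D : ℕ) :
    (weightGrading w p).natDegree ≤ D ↔ p ∈ restrictSupport K {a | ∑ i, w i * a i ≤ D} := by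
  rw [Polynomial.natDegree_le_iff_coeff_eq_zero, mem_restrictSupport_iff]
  constructor
  · intro h a ha
    by_contra hlt
    have := coeff_coeff_weightGrading w p (∑ i, w i * a i) a
    rw [h _ (not_le.1 hlt), if_pos rfl] at this
    exact (mem_support_iff.1 ha) this.symm
  · intro h k hk
    ext a
    rw [coeff_coeff_weightGrading, coeff_zero, ite_eq_right_iff]
    intro hak
    by_contra hne
    have h1 : ∑ i, w i * a i ≤ D := h (mem_support_iff.2 hne)
    omega

theorem mem_restrictSupport_of_mul [IsDomain K] (w : σ → ℕ) {p q : MvPolynomial σ K} {D : ℕ}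
    (hp : p ≠ 0) {m : σ →₀ ℕ} (hm : m ∈ p.support)
    (h : p * q ∈ restrictSupport K {a | ∑ i, w i * a i ≤ D + ∑ i, w i * m i}) :
    q ∈ restrictSupport K {a | ∑ i, w i * a i ≤ D} := by
  rcases eq_or_ne q 0 with rfl | hq
  · exact Submodule.zero_mem _
  rw [← natDegree_weightGrading_le_iff, map_mul, Polynomial.natDegree_mul
    (weightGrading_ne_zero w hp) (weightGrading_ne_zero w hq)] at h
  have h1 : ∑ i, w i * m i ≤ (weightGrading w p).natDegree :=
    (mem_restrictSupport_iff K).1 ((natDegree_weightGrading_le_iff w p _).1 le_rfl) hm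
  rw [← natDegree_weightGrading_le_iff]
  omega

end WeightGrading

section Perron

variable {K σ τ : Type*} [Field K]

theorem finrank_restrictSupport (s : Set (σ →₀ ℕ)) :
    Module.finrank K (restrictSupport K s) = Nat.card s :=
  Module.finrank_eq_nat_card_basis (basisRestrictSupport K s)

variable [Fintype σ]

theorem totalDegree_aeval_le_of_mem_restrictSupport {w : σ → ℕ}
    (ψ : MvPolynomial σ K →ₐ[K] MvPolynomial τ K) (hψ : ∀ i, (ψ (X i)).totalDegree ≤ w i)
    {D : ℕ} {p : MvPolynomial σ K} (hp : p ∈ restrictSupport K {a | ∑ i, w i * a i ≤ D}) :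
    ψ p ∈ restrictTotalDegree τ K D := by
  suffices h : restrictSupport K {a | ∑ i, w i * a i ≤ D} ≤
      (restrictTotalDegree τ K D).comap ψ.toLinearMap from h hp
  rw [restrictSupport_eq_span, Submodule.span_le]
  rintro _ ⟨a, ha, rfl⟩
  have ha' : ∑ i, w i * a i ≤ D := ha
  simp only [SetLike.mem_coe, Submodule.mem_comap, AlgHom.toLinearMap_apply,
    mem_restrictTotalDegree]
  rw [monomial_eq, Finsupp.prod_fintype _ _ (by simp), C_1, one_mul, map_prod]
  refine (totalDegree_finsetProd _ _).trans ((Finset.sum_le_sum fun i _ => ?_).trans ha')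
  rw [map_pow, mul_comm]
  exact (totalDegree_pow _ _).trans (Nat.mul_le_mul_left _ (hψ i))

variable [Fintype τ]

theorem card_le_card_add_choose {w : σ → ℕ} (hw : ∀ i, 1 ≤ w i)
    (ψ : MvPolynomial σ K →ₐ[K] MvPolynomial τ K) (hψ : ∀ i, (ψ (X i)).totalDegree ≤ w i)
    {Q : MvPolynomial σ K} (hQ : ∀ p, ψ p = 0 → Q ∣ p) {m : σ →₀ ℕ} (hm : m ∈ Q.support) (D : ℕ) :
    Nat.card {a : σ →₀ ℕ | ∑ i, w i * a i ≤ D + ∑ i, w i * m i} ≤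
      Nat.card {a : σ →₀ ℕ | ∑ i, w i * a i ≤ D} +
        (D + ∑ i, w i * m i + Fintype.card τ).choose (Fintype.card τ) := by
  set E := D + ∑ i, w i * m i with hE
  have hQ0 : Q ≠ 0 := by
    rintro rfl
    simp at hm
  have hfin : ∀ D, Module.Finite K (restrictSupport K {a : σ →₀ ℕ | ∑ i, w i * a i ≤ D}) := by
    intro D
    have := (Finsupp.finite_setOf_sum_mul_le hw D).to_subtype
    exact Module.Finite.of_basis (basisRestrictSupport K _)
  have := hfin D
  have := hfin E
  let V := restrictSupport K {a : σ →₀ ℕ | ∑ i, w i * a i ≤ E}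
  let f : V →ₗ[K] restrictTotalDegree τ K E :=
    (ψ.toLinearMap.domRestrict V).codRestrict _
      fun p => totalDegree_aeval_le_of_mem_restrictSupport ψ hψ p.2
  have hker : Module.finrank K (LinearMap.ker f) ≤
      Nat.card {a : σ →₀ ℕ | ∑ i, w i * a i ≤ D} := by
    rw [← finrank_restrictSupport (K := K), ← Submodule.finrank_map_subtype_eq]
    refine le_trans (Submodule.finrank_mono ?_) (Submodule.finrank_map_le (LinearMap.mulLeft K Q) _)
    rintro _ ⟨p, hp, rfl⟩
    have hp0 : ψ p.1 = 0 := congrArg Subtype.val (LinearMap.mem_ker.1 hp)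
    obtain ⟨q, hq⟩ := hQ _ hp0
    refine ⟨q, mem_restrictSupport_of_mul w hQ0 hm ?_, by simpa using hq.symm⟩
    rw [← hq]
    exact p.2
  have hrange : Module.finrank K (LinearMap.range f) ≤
      (E + Fintype.card τ).choose (Fintype.card τ) := by
    refine (Submodule.finrank_le _).trans (le_of_eq ?_)
    rw [← Finsupp.card_setOf_sum_le, restrictTotalDegree, finrank_restrictSupport]
    simp [Finsupp.sum_fintype]
  rw [← finrank_restrictSupport (K := K), ← LinearMap.finrank_range_add_finrank_ker f]
  omega

/-- **Perron bound**: more polynomials than variables satisfy relations of controlled weight. If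
every relation among them is a multiple of `Q`, then the weighted degree of `Q` is at most the
product of the degrees. -/
theorem sum_mul_le_prod_of_dvd {w : σ → ℕ} (hw : ∀ i, 1 ≤ w i)
    (hcard : Fintype.card τ < Fintype.card σ)
    (ψ : MvPolynomial σ K →ₐ[K] MvPolynomial τ K) (hψ : ∀ i, (ψ (X i)).totalDegree ≤ w i)
    {Q : MvPolynomial σ K} (hQ : ∀ p, ψ p = 0 → Q ∣ p) {m : σ →₀ ℕ} (hm : m ∈ Q.support) :
    ∑ i, w i * m i ≤ ∏ i, w i := by
  obtain ⟨k, hk⟩ : ∃ k, Fintype.card σ = k + 1 := ⟨Fintype.card σ - 1, by omega⟩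
  refine Nat.le_of_choose_growth (m := k)
    (fun D => Nat.card {a : σ →₀ ℕ | ∑ i, w i * a i ≤ D}) ?_ ?_ ?_
  · have : Subsingleton {a : σ →₀ ℕ | ∑ i, w i * a i ≤ 0} := by
      suffices h : ∀ a : σ →₀ ℕ, ∑ i, w i * a i ≤ 0 → a = 0 from
        ⟨fun a b => Subtype.ext ((h _ a.2).trans (h _ b.2).symm)⟩
      intro a ha
      ext i
      have h1 := Finset.sum_eq_zero_iff.1 (Nat.le_zero.1 ha) i (Finset.mem_univ i)
      have h2 := hw i
      rcases Nat.mul_eq_zero.1 h1 with h | h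
      · omega
      · exact h
    exact Finite.card_le_one_iff_subsingleton.2 this
  · intro D
    rw [← hk]
    exact Finsupp.choose_le_prod_mul_card hw D
  · intro D
    refine (card_le_card_add_choose hw ψ hψ hQ hm D).trans (Nat.add_le_add_left ?_ _)
    rw [← Nat.choose_symm_add, ← Nat.choose_symm_add]
    exact Nat.choose_le_choose _ (by omega)

end Perron

theorem isAlgebraic_adjoin_of_eq_top {R A : Type*} [CommRing R] [CommRing A] [Nontrivial A]
    [Algebra R A] {S : Subalgebra R A} (hS : S = ⊤) : Algebra.IsAlgebraic S A := by
  subst hS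
  exact ⟨fun p => isAlgebraic_algebraMap (⟨p, trivial⟩ : (⊤ : Subalgebra R A))⟩

section Elimination

variable {K ρ τ : Type*} [Field K]

theorem trdeg_range_lt [Fintype ρ] {B : Type*} [CommRing B] [IsDomain B] [Algebra K B]
    (φ : MvPolynomial ρ K →ₐ[K] B) (hφ : ¬ Function.Injective φ) :
    Algebra.trdeg K φ.range < Fintype.card ρ := by
  by_contra! hle
  let x : ρ → φ.range := fun i => φ.rangeRestrict (X i)
  have hx : aeval x = φ.rangeRestrict := by
    ext i
    simp [x]
  have halg : Algebra.IsAlgebraic (Algebra.adjoin K (Set.range x)) φ.range := by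
    have htop : Algebra.adjoin K (Set.range x) = ⊤ := by
      rw [Algebra.adjoin_range_eq_range_aeval, hx, AlgHom.range_eq_top]
      exact φ.rangeRestrict_surjective
    exact isAlgebraic_adjoin_of_eq_top htop
  have hb := Algebra.IsAlgebraic.isTranscendenceBasis_of_lift_le_trdeg_of_finite K x (by simpa using hle)
  have hinj : Function.Injective (aeval (R := K) x) := hb.1
  rw [hx] at hinj
  exact hφ fun p q hpq => hinj (Subtype.ext hpq)

theorem exists_algebraicIndependent_of_subalgebra [Fintype τ] {B : Type*} [CommRing B]
    [IsDomain B] [Algebra K B] (A : Subalgebra K B) {x : τ → B} (hinj : Function.Injective x)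
    (hx : Algebra.adjoin K (Set.range x) = ⊤) :
    ∃ s : Finset τ, Algebra.trdeg K B = Algebra.trdeg K A + s.card ∧
      AlgebraicIndependent A (fun i : s => x i.1) := by
  classical
  have halg : Algebra.IsAlgebraic (Algebra.adjoin A (Set.range x)) B := by
    refine isAlgebraic_adjoin_of_eq_top (eq_top_iff.2 fun p _ => ?_)
    have hle : Algebra.adjoin K (Set.range x) ≤
        (Algebra.adjoin A (Set.range x)).restrictScalars K :=
      Algebra.adjoin_le Algebra.subset_adjoin
    rw [hx] at hle
    exact hle trivial
  obtain ⟨t, ht, htb⟩ := exists_isTranscendenceBasis_subset (R := A) (Set.range x)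
  obtain ⟨s, hst⟩ : ∃ s : Finset τ, ∀ i, i ∈ s ↔ x i ∈ t :=
    ⟨Finset.univ.filter fun i => x i ∈ t, by simp⟩
  have hs : Function.Bijective (fun i : s => (⟨x i.1, (hst i.1).1 i.2⟩ : t)) := by
    constructor
    · intro i j hij
      exact Subtype.ext (hinj (congrArg Subtype.val hij))
    · rintro ⟨p, hp⟩
      obtain ⟨i, rfl⟩ := ht hp
      exact ⟨⟨i, (hst i).2 hp⟩, rfl⟩
  have hind := AlgebraicIndependent.comp htb.1 _ hs.1
  refine ⟨s, ?_, hind⟩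
  have hcard : Cardinal.mk t = s.card := by
    have := Cardinal.mk_congr_lift (Equiv.ofBijective _ hs)
    simpa using this.symm
  rw [← trdeg_add_eq K A (A := B), ← htb.cardinalMk_eq_trdeg, hcard]

theorem exists_algebraicIndependent_X [Fintype ρ] [Fintype τ]
    (φ : MvPolynomial ρ K →ₐ[K] MvPolynomial τ K) (hφ : ¬ Function.Injective φ) :
    ∃ s : Finset τ, Fintype.card τ < s.card + Fintype.card ρ ∧
      AlgebraicIndependent φ.range (fun i : s => (X i.1 : MvPolynomial τ K)) := by
  obtain ⟨s, hs, hind⟩ := exists_algebraicIndependent_of_subalgebra φ.range X_injective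
    (adjoin_range_X (R := K) (σ := τ))
  refine ⟨s, ?_, hind⟩
  have hlt := trdeg_range_lt φ hφ
  obtain ⟨k, hk⟩ := Cardinal.lt_aleph0.1 (hlt.trans Cardinal.natCast_lt_aleph0)
  rw [hk, trdeg_of_isDomain, Cardinal.mk_fintype, Cardinal.lift_natCast] at hs
  rw [hk] at hlt
  norm_cast at hs hlt
  omega

theorem rename_inr_dvd_of_aeval_eq_zero {ι B : Type*} [CommRing B] [Algebra K B]
    (φ : MvPolynomial ρ K →ₐ[K] B) {x : ι → B} (hx : AlgebraicIndependent φ.range x)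
    {P : MvPolynomial ρ K} (hP : RingHom.ker φ = Ideal.span {P}) {p : MvPolynomial (ι ⊕ ρ) K}
    (hp : aeval (Sum.elim x fun j => φ (X j)) p = 0) : rename Sum.inr P ∣ p := by
  have key : ∀ p : MvPolynomial (ι ⊕ ρ) K, aeval (Sum.elim x fun j => φ (X j)) p =
      aeval x (map φ.rangeRestrict.toRingHom (sumAlgEquiv K ι ρ p)) := by
    intro p
    induction p using MvPolynomial.induction_on with
    | C a =>
      simp [sumAlgEquiv_C_inl]
    | add p q hp hq => simp only [map_add, hp, hq]
    | mul_X p i hp =>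
      rw [map_mul, map_mul, map_mul, map_mul, hp]
      rcases i with i | i
      · simp
      · simp
  have h0 : map φ.rangeRestrict.toRingHom (sumAlgEquiv K ι ρ p) = 0 :=
    hx ((key p).symm.trans hp |>.trans (map_zero _).symm)
  have hdvd : C P ∣ sumAlgEquiv K ι ρ p := by
    rw [C_dvd_iff_dvd_coeff]
    intro a
    rw [← Ideal.mem_span_singleton, ← hP, RingHom.mem_ker]
    have := congrArg (fun q : MvPolynomial ι φ.range => ((coeff a q : φ.range) : B)) h0
    simpa [coeff_map] using this
  have hC : sumAlgEquiv K ι ρ (rename Sum.inr P) = C P := by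
    have := DFunLike.congr_fun (sumAlgEquiv_comp_rename_inr (R := K) (S₁ := ι) (S₂ := ρ)) P
    simpa using this
  rw [← hC] at hdvd
  exact (map_dvd_iff (sumAlgEquiv K ι ρ)).1 hdvd

end Elimination

theorem totalDegree_derivation_le {K σ : Type*} [Field K] [CharZero K]
    (L : Derivation ℚ (MvPolynomial σ K) (MvPolynomial σ K)) {G : ℕ}
    (hLC : ∀ c : K, ∃ c' : K, L (C c) = C c')
    (hLX : ∀ i, (L (X i)).totalDegree ≤ G + 1) (p : MvPolynomial σ K) :
    (L p).totalDegree ≤ p.totalDegree + G := by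
  have hmon : ∀ (a : σ →₀ ℕ) (c : K),
      (L (monomial a c)).totalDegree ≤ (monomial a c).totalDegree + G := by
    refine induction_on_monomial (motive := fun p => (L p).totalDegree ≤ p.totalDegree + G)
      (fun c => ?_) fun p i hp => ?_
    · obtain ⟨c', hc'⟩ := hLC c
      simp [hc']
    · rcases eq_or_ne p 0 with rfl | hp0
      · simp
      rw [Derivation.leibniz, totalDegree_mul_of_isDomain hp0 (X_ne_zero i), totalDegree_X, smul_eq_mul, smul_eq_mul]
      refine (totalDegree_add _ _).trans (max_le ?_ ?_)
      · have h1 := totalDegree_mul p (L (X i))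
        have h2 := hLX i
        omega
      · have h1 := totalDegree_mul (X i) (L p)
        rw [totalDegree_X] at h1
        omega
  rw [p.as_sum, map_sum, ← p.as_sum]
  refine totalDegree_finsetSum_le fun a ha => (hmon a _).trans (Nat.add_le_add_right ?_ _)
  exact (totalDegree_monomial_le _ _).trans (le_totalDegree ha)

theorem totalDegree_iterate_derivation_le {K σ : Type*} [Field K] [CharZero K]
    (L : Derivation ℚ (MvPolynomial σ K) (MvPolynomial σ K)) {G : ℕ}
    (hLC : ∀ c : K, ∃ c' : K, L (C c) = C c')
    (hLX : ∀ i, (L (X i)).totalDegree ≤ G + 1) (p : MvPolynomial σ K) (k : ℕ) :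
    ((⇑L)^[k] p).totalDegree ≤ p.totalDegree + k * G := by
  induction k with
  | zero => simp
  | succ k ih =>
    rw [Function.iterate_succ_apply']
    have := totalDegree_derivation_le L hLC hLX ((⇑L)^[k] p)
    rw [add_mul, one_mul]
    omega

theorem totalDegree_le_degMu_add_degXv {K : Type*} [CommSemiring K] {r n : ℕ}
    (p : MvPolynomial (Fin r ⊕ Fin n) K) : p.totalDegree ≤ degMu p + degXv p := by
  refine Finset.sup_le fun m hm => ?_
  rw [Finsupp.sum_fintype _ _ (by simp), Fintype.sum_sum_type]
  exact Nat.add_le_add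
    (Finset.le_sup (f := fun m : Fin r ⊕ Fin n →₀ ℕ => ∑ j, m (Sum.inl j)) hm)
    (Finset.le_sup (f := fun m : Fin r ⊕ Fin n →₀ ℕ => ∑ i, m (Sum.inr i)) hm)

end MvPolynomial

theorem stmt1 {K : Type*} [Field K] [CharZero K] {r n : ℕ} (hn : 1 ≤ n)
    (g : Fin n → MvPolynomial (Fin r ⊕ Fin n) K) (f : MvPolynomial (Fin r ⊕ Fin n) K)
    (L : Derivation ℚ (MvPolynomial (Fin r ⊕ Fin n) K) (MvPolynomial (Fin r ⊕ Fin n) K))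
    (hLx : ∀ i, L (X (Sum.inr i)) = g i)
    (hLmu : ∀ j, L (X (Sum.inl j)) = 0)
    (hLC : ∀ c : K, ∃ c' : K, L (C c) = C c')
    (dmu dx Dmu Dx : ℕ)
    (hdmu : dmu = degMu f) (hdx : dx = degXv f)
    (hDmu : Dmu = Finset.univ.sup fun i => degMu (g i))
    (hDx : Dx = Finset.univ.sup fun i => degXv (g i))
    (hdx1 : 1 ≤ dx) (hDx1 : 1 ≤ Dx)
    (ν : ℕ)
    (hinj : ∀ ν' < ν, RingHom.ker (liePhi f L ν') = ⊥)
    (P : MvPolynomial (Fin r ⊕ Fin (ν + 1)) K) (hP0 : P ≠ 0)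
    (hPgen : RingHom.ker (liePhi f L ν) = Ideal.span {P}) :
    ∀ m ∈ P.support,
      (∑ j : Fin r, m (Sum.inl j)) +
          (∑ i : Fin (ν + 1), (dx + (i : ℕ) * (Dx - 1)) * m (Sum.inr i)) ≤
        ∏ i : Fin (ν + 1), (dx + dmu + (i : ℕ) * (Dx + Dmu - 1)) := by
  set φ := liePhi f L ν
  have hPker : φ P = 0 := by
    rw [← RingHom.mem_ker, hPgen]
    exact Ideal.mem_span_singleton_self P
  have hninj : ¬ Function.Injective φ := fun h => hP0 (h (hPker.trans (map_zero φ).symm))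
  have htot : ∀ p : MvPolynomial (Fin r ⊕ Fin n) K, p.totalDegree ≤ degMu p + degXv p :=
    totalDegree_le_degMu_add_degXv
  have hG : Dx + Dmu - 1 + 1 = Dx + Dmu := by omega
  have hLX : ∀ i, (L (X i)).totalDegree ≤ (Dx + Dmu - 1) + 1 := by
    rw [hG]
    rintro (j | i)
    · simp [hLmu]
    · rw [hLx]
      have h1 : degMu (g i) ≤ Dmu :=
        hDmu ▸ Finset.le_sup (f := fun i => degMu (g i)) (Finset.mem_univ i)
      have h2 : degXv (g i) ≤ Dx :=
        hDx ▸ Finset.le_sup (f := fun i => degXv (g i)) (Finset.mem_univ i)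
      have h3 := htot (g i)
      omega
  obtain ⟨s, hs, hind⟩ := exists_algebraicIndependent_X φ hninj
  let N : Fin (ν + 1) → ℕ := fun i => dx + dmu + (i : ℕ) * (Dx + Dmu - 1)
  let w : s ⊕ (Fin r ⊕ Fin (ν + 1)) → ℕ := Sum.elim (fun _ => 1) (Sum.elim (fun _ => 1) N)
  have hw : ∀ i, 1 ≤ w i := by
    rintro (i | j | i)
    · exact le_rfl
    · exact le_rfl
    · exact hdx1.trans ((Nat.le_add_right _ _).trans (Nat.le_add_right _ _))
  have hdeg : ∀ i, (aeval (R := K) (Sum.elim (fun i : s => (X i.1 : MvPolynomial _ K))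
      fun j => φ (X j)) (X i)).totalDegree ≤ w i := by
    rintro (i | j | i)
    · simp [w]
    · simp [w, φ, liePhi]
    · have h1 := totalDegree_iterate_derivation_le L hLC hLX f i
      have h2 := htot f
      simp only [aeval_X, Sum.elim_inr, φ, liePhi, w, N]
      omega
  intro m hm
  have hm' : m.mapDomain Sum.inr ∈ (rename (Sum.inr : _ → s ⊕ _) P).support := by
    rw [mem_support_iff, coeff_rename_mapDomain _ Sum.inr_injective]
    exact mem_support_iff.1 hm
  have hmain := sum_mul_le_prod_of_dvd hw (by simpa using hs) _ hdeg
    (fun p hp => rename_inr_dvd_of_aeval_eq_zero φ hind hPgen hp) hm'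
  have hinl : ∀ i : s, m.mapDomain (Sum.inr : _ → s ⊕ _) (Sum.inl i) = 0 := fun i =>
    Finsupp.mapDomain_of_notMem_range _ _ (by simp)
  simp only [Fintype.sum_sum_type, Fintype.prod_sum_type, w, Sum.elim_inl, Sum.elim_inr, hinl,
    Finsupp.mapDomain_apply Sum.inr_injective, Finset.prod_const_one, one_mul, mul_zero,
    Finset.sum_const_zero, zero_add] at hmain
  refine le_trans (Nat.add_le_add_left (Finset.sum_le_sum fun i _ => Nat.mul_le_mul_right _ ?_) _)
    hmain
  exact Nat.add_le_add (Nat.le_add_right _ _) (Nat.mul_le_mul_left _ (by omega))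
end

section
/- Assume d ≥ 1 and D ≥ 1. Suppose ν ∈ ℕ is such that ker φ_{ν'} = 0 for every ν' < ν, and ker φ_ν is the principal ideal generated by a nonzero polynomial P ∈ K[y_0,…,y_ν] (this P is the minimal polynomial of the differential elimination ideal of the non-parametric system x' = g(x), y = f(x)). Then for every monomial y_0^{e_0}···y_ν^{e_ν} occurring in P one has Σ_{k=0}^{ν} (d + k·(D − 1))·e_k ≤ Π_{k=0}^{ν} (d + k·(D − 1)). -/
open MvPolynomial

/-- The `K`-algebra homomorphism `φ_ν : K[y_0,…,y_ν] → K[x_1,…,x_n]`,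
sending `y_k ↦ L^k(f)`. -/
noncomputable def liePhiNP {K : Type*} [Field K] [CharZero K] {n : ℕ}
    (f : MvPolynomial (Fin n) K)
    (L : Derivation ℚ (MvPolynomial (Fin n) K) (MvPolynomial (Fin n) K))
    (ν : ℕ) :
    MvPolynomial (Fin (ν + 1)) K →ₐ[K] MvPolynomial (Fin n) K :=
  aeval (fun k : Fin (ν + 1) => (⇑L)^[(k : ℕ)] f)

theorem ncard_degree_le (σ : Type*) [Fintype σ] (N : ℕ) :
    {a : σ →₀ ℕ | a.degree ≤ N}.ncard = (N + Fintype.card σ).choose (Fintype.card σ) := by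
  classical
  have key : (Finset.univ.finsuppAntidiag N : Finset (Option σ →₀ ℕ)).card =
      {a : σ →₀ ℕ | a.degree ≤ N}.ncard := by
    rw [← Set.ncard_coe_finset]
    refine Set.ncard_congr (fun b _ => b.some) ?_ ?_ ?_
    · intro b hb
      simp only [Finset.mem_coe, Finset.mem_finsuppAntidiag,
        Fintype.sum_option] at hb
      simp only [Set.mem_ofPred_eq, Finsupp.degree_eq_sum, Finsupp.some_apply]
      omega
    · intro b c hb hc h
      simp only [Finset.mem_coe, Finset.mem_finsuppAntidiag, Fintype.sum_option] at hb hc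
      have h' : ∀ i, b (some i) = c (some i) := fun i => DFunLike.congr_fun h i
      simp only [h'] at hb
      ext i
      cases i with
      | none => omega
      | some i => exact h' i
    · intro a ha
      refine ⟨a.optionElim (N - a.degree), ?_, by ext; simp⟩
      simp only [Set.mem_ofPred_eq, Finsupp.degree_eq_sum] at ha
      simp [Finset.mem_finsuppAntidiag, Fintype.sum_option, Finsupp.degree_eq_sum, ha]
  rw [← key, Finset.card_finsuppAntidiag_nat_eq_choose, Finset.card_univ, Fintype.card_option,
    show Fintype.card σ + 1 + N - 1 = N + Fintype.card σ by omega, Nat.choose_symm_add]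

theorem choose_le_prod_mul_ncard_weight_le {σ : Type*} [Fintype σ] (w : σ → ℕ)
    (hw : ∀ k, w k ≠ 0) (N : ℕ) :
    (N + Fintype.card σ).choose (Fintype.card σ) ≤
      (∏ k, w k) * {a : σ →₀ ℕ | Finsupp.weight w a ≤ N}.ncard := by
  classical
  have hT := Finsupp.finite_of_nat_weight_le w hw N
  have hS : {a : σ →₀ ℕ | a.degree ≤ N}.Finite := Finsupp.finite_of_degree_le N
  rw [← ncard_degree_le, Set.ncard_eq_toFinset_card _ hS, Set.ncard_eq_toFinset_card _ hT]
  let F : (σ →₀ ℕ) → (σ →₀ ℕ) := fun b => Finsupp.equivFunOnFinite.symm fun k => b k / w k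
  have hF : ∀ b k, F b k = b k / w k := fun b k => rfl
  refine Finset.card_le_mul_card_image_of_maps_to (f := F) ?_ _ ?_
  · intro b hb
    simp only [Set.Finite.mem_toFinset, Set.mem_ofPred_eq,
      Finsupp.degree_eq_sum] at hb
    simp only [Set.Finite.mem_toFinset, Set.mem_ofPred_eq, 
      Finsupp.weight_eq_sum, hF, smul_eq_mul]
    exact (Finset.sum_le_sum fun k _ => Nat.div_mul_le_self _ _).trans hb
  · intro a _
    have : (∏ k, w k) = (Fintype.piFinset fun k => Finset.range (w k)).card := by simp
    rw [this]
    refine Finset.card_le_card_of_injOn (fun b k => b k % w k) ?_ ?_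
    · intro b _
      simp [Nat.mod_lt _ (Nat.pos_of_ne_zero (hw _))]
    · intro b hb c hc h
      simp only [Finset.coe_filter, Set.mem_ofPred_eq] at hb hc
      ext k
      have h1 : b k / w k = c k / w k := by rw [← hF, ← hF, hb.2, hc.2]
      rw [← Nat.div_add_mod (b k) (w k), h1, show b k % w k = c k % w k from congr_fun h k,
        Nat.div_add_mod]

theorem mul_sum_choose_le (W r J : ℕ) :
    W * ∑ j ∈ Finset.range J, (j * W + r).choose r ≤
      ∑ i ∈ Finset.range (J * W), (i + r).choose r := by
  induction J with
  | zero => simp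
  | succ J ih =>
    rw [Finset.sum_range_succ, mul_add, Nat.succ_mul, Finset.sum_range_add]
    refine add_le_add ih ?_
    calc W * (J * W + r).choose r = ∑ _i ∈ Finset.range W, (J * W + r).choose r := by simp
      _ ≤ _ := Finset.sum_le_sum fun i _ => Nat.choose_le_choose _ (by omega)

open Filter Topology in
theorem le_of_forall_mul_choose_le {W p r c : ℕ} (hW : 0 < W)
    (h : ∀ J : ℕ, W * (J * W + r).choose r ≤ p * (J * W + c).choose r) : W ≤ p := by
  have hpow : ∀ J : ℕ, (W : ℝ) * ((J * W + 1 : ℕ) : ℝ) ^ r ≤ p * ((J * W + c : ℕ) : ℝ) ^ r := by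
    intro J
    have h1 := Nat.pow_le_choose (α := ℝ) r (J * W + r)
    have h2 := Nat.choose_le_pow_div (α := ℝ) r (J * W + c)
    have h3 : (W : ℝ) * (J * W + r).choose r ≤ p * (J * W + c).choose r := by exact_mod_cast h J
    rw [show J * W + r + 1 - r = J * W + 1 by omega] at h1
    have hf : (0 : ℝ) < r.factorial := by positivity
    have h4 : (W : ℝ) * (((J * W + 1 : ℕ) : ℝ) ^ r / r.factorial) ≤
        p * (((J * W + c : ℕ) : ℝ) ^ r / r.factorial) :=
      (mul_le_mul_of_nonneg_left h1 (by positivity)).trans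
        (h3.trans (mul_le_mul_of_nonneg_left h2 (by positivity)))
    rwa [← mul_div_assoc, ← mul_div_assoc, div_le_div_iff_of_pos_right hf] at h4
  have hW' : (W : ℝ) ≠ 0 := by positivity
  have hlim : ∀ e : ℕ, Tendsto (fun J : ℕ => ((J * W + e : ℕ) : ℝ) / J) atTop (𝓝 W) := by
    intro e
    have : Tendsto (fun J : ℕ => (W : ℝ) + (e : ℝ) / J) atTop (𝓝 (W + 0)) :=
      tendsto_const_nhds.add (tendsto_const_div_atTop_nhds_zero_nat _)
    rw [add_zero] at this
    refine this.congr' ?_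
    filter_upwards [eventually_gt_atTop 0] with J hJ
    have : (J : ℝ) ≠ 0 := by positivity
    push_cast
    field_simp
  have hle : (W : ℝ) * (W : ℝ) ^ r ≤ p * (W : ℝ) ^ r := by
    refine le_of_tendsto_of_tendsto (((hlim 1).pow r).const_mul (W : ℝ))
      (((hlim c).pow r).const_mul (p : ℝ)) ?_
    filter_upwards [eventually_gt_atTop 0] with J hJ
    have : (0 : ℝ) < (J : ℝ) ^ r := by positivity
    rw [div_pow, div_pow, ← mul_div_assoc, ← mul_div_assoc, div_le_div_iff_of_pos_right this]
    exact hpow J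
  exact_mod_cast le_of_mul_le_mul_right hle (by positivity)

theorem le_prod_of_ncard_weight_growth {r : ℕ} (w : Fin (r + 1) → ℕ) (hw : ∀ k, w k ≠ 0)
    {W : ℕ} (hW : 0 < W)
    (h : ∀ N : ℕ, {a : Fin (r + 1) →₀ ℕ | Finsupp.weight w a ≤ N + W}.ncard ≤
      {a : Fin (r + 1) →₀ ℕ | Finsupp.weight w a ≤ N}.ncard + (N + W + r).choose r) :
    W ≤ ∏ k, w k := by
  refine le_of_forall_mul_choose_le hW (r := r + 1) (c := W + r) fun J => ?_
  have h0 : ∀ J, {a : Fin (r + 1) →₀ ℕ | Finsupp.weight w a ≤ J * W}.ncard ≤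
      ∑ j ∈ Finset.range (J + 1), (j * W + r).choose r := by
    intro J
    induction J with
    | zero =>
      have : {a : Fin (r + 1) →₀ ℕ | Finsupp.weight w a ≤ 0} = {0} := by
        have := Finsupp.nonTorsionWeight_of (R := ℕ) (w := w) hw
        ext a
        simp [Finsupp.weight_eq_zero_iff_eq_zero]
      simp only [zero_mul, this]
      simp
    | succ J ih =>
      rw [Finset.sum_range_succ, Nat.succ_mul]
      exact (h (J * W)).trans (by gcongr)
  have h1 := choose_le_prod_mul_ncard_weight_le w hw (J * W)
  rw [Fintype.card_fin] at h1
  have h2 := mul_sum_choose_le W r (J + 1)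
  have h3 : ∑ i ∈ Finset.range ((J + 1) * W), (i + r).choose r =
      (J * W + (W + r)).choose (r + 1) := by
    obtain ⟨W, rfl⟩ : ∃ V, W = V + 1 := ⟨W - 1, by omega⟩
    rw [show (J + 1) * (W + 1) = (J * (W + 1) + W) + 1 by ring, Nat.sum_range_add_choose]
    congr 1
    ring
  calc _ ≤ W * ((∏ k, w k) * _) := Nat.mul_le_mul_left W h1
    _ = (∏ k, w k) * (W * _) := by ring
    _ ≤ _ := Nat.mul_le_mul_left _ (((Nat.mul_le_mul_left W (h0 J)).trans h2).trans h3.le)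

theorem trdeg_adjoin_range_le_of_not_algebraicIndependent {K R : Type*} [Field K] [CommRing R]
    [IsDomain R] [Algebra K R] {ν : ℕ} (F : Fin (ν + 1) → R) (hF : ¬ AlgebraicIndependent K F) :
    Algebra.trdeg K (Algebra.adjoin K (Set.range F)) ≤ ν := by
  have hmem : ∀ k, F k ∈ Algebra.adjoin K (Set.range F) := fun k =>
    Algebra.subset_adjoin ⟨k, rfl⟩
  let F' : Fin (ν + 1) → Algebra.adjoin K (Set.range F) := fun k => ⟨F k, hmem k⟩
  have htop : Algebra.adjoin K (Set.range F') = ⊤ := by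
    rw [eq_top_iff]
    rintro ⟨x, hx⟩ -
    have h1 : (Algebra.adjoin K (Set.range F')).map (Algebra.adjoin K (Set.range F)).val =
        Algebra.adjoin K (Set.range F) := by
      rw [AlgHom.map_adjoin, ← Set.range_comp]
      rfl
    rw [← h1] at hx
    obtain ⟨y, hy, hyx⟩ := hx
    convert! hy
    exact hyx.symm
  have : Algebra.IsAlgebraic (Algebra.adjoin K (Set.range F'))
      (Algebra.adjoin K (Set.range F)) := by
    rw [htop]
    exact ⟨fun x => isAlgebraic_algebraMap (⟨x, trivial⟩ : (⊤ : Subalgebra K _))⟩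
  obtain ⟨t, ht, hbas⟩ := exists_isTranscendenceBasis_subset (R := K) (Set.range F')
  choose s hs using fun x : t => ht x.2
  have hinj : Function.Injective s := fun x y h => Subtype.ext (by rw [← hs x, ← hs y, h])
  have : Finite t := Finite.of_injective s hinj
  rw [← hbas.cardinalMk_eq_trdeg, ← Nat.cast_card, Nat.cast_le]
  by_contra! hlt
  have hbij : Function.Bijective s := by
    rw [Nat.bijective_iff_injective_and_card]
    refine ⟨hinj, le_antisymm ?_ ?_⟩
    · exact Nat.card_le_card_of_injective s hinj
    · simpa using hlt
  refine hF ?_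
  have h2 : AlgebraicIndependent K F' := by
    rw [← algebraicIndependent_equiv (Equiv.ofBijective s hbij)]
    convert hbas.1
    funext x
    exact hs x
  exact h2.map' (f := (Algebra.adjoin K (Set.range F)).val) Subtype.val_injective

theorem exists_algebraicIndependent_X_card_compl_le {K σ : Type*} [Field K] [Fintype σ]
    (A : Subalgebra K (MvPolynomial σ K)) {r : ℕ} (hA : Algebra.trdeg K A ≤ r) :
    ∃ I : Set σ, AlgebraicIndependent A (fun i : I => (X (i : σ) : MvPolynomial σ K)) ∧
      Nat.card (Iᶜ : Set σ) ≤ r := by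
  classical
  have : Algebra.IsAlgebraic (Algebra.adjoin A (Set.range (X : σ → MvPolynomial σ K)))
      (MvPolynomial σ K) := by
    have htop : Algebra.adjoin A (Set.range (X : σ → MvPolynomial σ K)) = ⊤ := by
      rw [eq_top_iff]
      intro p _
      have hp : p ∈ Algebra.adjoin K (Set.range (X : σ → MvPolynomial σ K)) := by
        rw [adjoin_range_X]; trivial
      have hle : Algebra.adjoin K (Set.range (X : σ → MvPolynomial σ K)) ≤
        (Algebra.adjoin A (Set.range (X : σ → MvPolynomial σ K))).restrictScalars K :=
        Algebra.adjoin_le Algebra.subset_adjoin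
      exact hle hp
    rw [htop]
    exact ⟨fun x => isAlgebraic_algebraMap (⟨x, trivial⟩ : (⊤ : Subalgebra A _))⟩
  obtain ⟨t, ht, hbas⟩ := exists_isTranscendenceBasis_subset (R := A)
    (Set.range (X : σ → MvPolynomial σ K))
  choose s hs using fun x : t => ht x.2
  have hinj : Function.Injective s := fun x y h => Subtype.ext (by rw [← hs x, ← hs y, h])
  have : Finite t := Finite.of_injective s hinj
  refine ⟨Set.range s, ?_, ?_⟩
  · rw [← algebraicIndependent_equiv (Equiv.ofInjective s hinj)]
    convert hbas.1
    funext x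
    exact hs x
  · have hadd := lift_trdeg_add_eq K A (MvPolynomial σ K)
    obtain ⟨a, ha⟩ := Cardinal.lt_aleph0.mp (hA.trans_lt (Cardinal.natCast_lt_aleph0))
    have har : a ≤ r := by rw [ha] at hA; exact_mod_cast hA
    rw [trdeg_of_isDomain, ← hbas.cardinalMk_eq_trdeg, ha, ← Nat.cast_card,
      Cardinal.mk_fintype] at hadd
    simp only [Cardinal.lift_natCast] at hadd
    have hadd' : a + Nat.card t = Fintype.card σ := by exact_mod_cast hadd
    have hcompl := Set.ncard_add_ncard_compl (Set.range s)
    rw [Nat.card_eq_fintype_card, ← Nat.card_coe_set_eq, ← Nat.card_coe_set_eq,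
      ← Nat.card_congr (Equiv.ofInjective s hinj)] at hcompl
    omega

theorem linearIndependent_supported_of_algebraicIndependent {K σ ι : Type*} [Field K]
    (A : Subalgebra K (MvPolynomial σ K)) {I : Set σ}
    (hI : AlgebraicIndependent A (fun i : I => (X (i : σ) : MvPolynomial σ K)))
    {v : ι → MvPolynomial σ K} (hvA : ∀ i, v i ∈ A) (hv : LinearIndependent K v) :
    LinearIndependent (supported K I) v := by
  rw [linearIndependent_iff']
  intro s b hb i hi
  have hex : ∀ i, ∃ q : MvPolynomial I K, rename (↑) q = (b i : MvPolynomial σ K) := by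
    intro i
    have h : ∀ p ∈ supported K I, ∃ q : MvPolynomial I K, rename (↑) q = p := fun p hp => by
      rwa [supported_eq_range_rename, AlgHom.mem_range] at hp
    exact h _ (b i).2
  choose q hq using hex
  let Q : MvPolynomial I A := ∑ i ∈ s, C (⟨v i, hvA i⟩ : A) * map (algebraMap K A) (q i)
  have hQ : aeval (fun i : I => (X (i : σ) : MvPolynomial σ K)) Q = 0 := by
    rw [← hb]
    simp only [Q, map_sum, map_mul, aeval_C, aeval_map_algebraMap]
    refine Finset.sum_congr rfl fun i _ => ?_
    rw [Subalgebra.smul_def, ← hq, rename_eq_aeval, smul_eq_mul, mul_comm]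
    rfl
  have hQ0 : Q = 0 := hI (by rw [hQ, map_zero])
  suffices q i = 0 by
    ext1
    rw [← hq, this]
    simp
  ext m
  have hc : ∑ i ∈ s, (q i).coeff m • v i = 0 := by
    have := congr_arg (fun p => ((coeff m p : A) : MvPolynomial σ K)) hQ0
    simp only [Q, coeff_sum, coeff_C_mul, coeff_map, coeff_zero] at this
    simp only [AddSubmonoidClass.coe_finsetSum, MulMemClass.coe_mul, ZeroMemClass.coe_zero] at this
    rw [← this]
    refine Finset.sum_congr rfl fun i _ => ?_
    rw [Algebra.smul_def, mul_comm]
    rfl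
  exact linearIndependent_iff'.mp hv s _ hc i hi

theorem restrictTotalDegree_le_span_supported {K σ : Type*} [Field K] (I : Set σ) (N : ℕ)
    {p : MvPolynomial σ K} (hp : p ∈ restrictTotalDegree σ K N) :
    p ∈ Submodule.span (supported K I)
      ((fun a : (Iᶜ : Set σ) →₀ ℕ => (monomial (a.mapDomain (↑)) 1 : MvPolynomial σ K)) ''
        {a | a.degree ≤ N}) := by
  classical
  rw [p.as_sum]
  refine Submodule.sum_mem _ fun m hm => ?_
  have hmN : m.degree ≤ N := hp hm
  have hsplit : monomial m (p.coeff m) = monomial (m.filter (· ∈ I)) (p.coeff m) *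
      (monomial (m.filter (· ∉ I)) 1 : MvPolynomial σ K) := by
    rw [monomial_mul, Finsupp.filter_add_filter_not, mul_one]
  rw [hsplit]
  have hmem : monomial (m.filter (· ∈ I)) (p.coeff m) ∈ supported K I := by
    rw [mem_supported]
    intro i hi
    obtain ⟨d, hd, hid⟩ := (mem_vars_iff_mem_support _).mp hi
    have hsub := support_monomial_subset hd
    rw [Finset.mem_singleton] at hsub
    rw [hsub, Finsupp.support_filter] at hid
    exact (Finset.mem_filter.mp hid).2
  refine Submodule.smul_mem _ (⟨_, hmem⟩ : supported K I) (Submodule.subset_span ?_)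
  have hmd : (m.subtypeDomain (· ∈ Iᶜ)).mapDomain (↑) = m.filter (· ∉ I) := by
    ext i
    by_cases hi : i ∈ I
    · rw [Finsupp.mapDomain_of_notMem_range _ _ (by simpa using hi),
        Finsupp.filter_apply_neg (· ∉ I) m (not_not.mpr hi)]
    · rw [Finsupp.filter_apply_pos (· ∉ I) m hi]
      exact Finsupp.mapDomain_apply Subtype.val_injective _ (⟨i, hi⟩ : (Iᶜ : Set σ))
  refine ⟨m.subtypeDomain (· ∈ Iᶜ), ?_, congr_arg (monomial · 1) hmd⟩
  have hdeg := Finsupp.degree_mapDomain (Subtype.val : (Iᶜ : Set σ) → σ)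
    (m.subtypeDomain (· ∈ Iᶜ))
  rw [hmd] at hdeg
  refine (hdeg.symm.trans_le (Finsupp.degree_mono fun i => ?_)).trans hmN
  rw [Finsupp.filter_apply]
  split_ifs <;> simp

theorem finrank_le_choose_of_trdeg_le {K σ : Type*} [Field K] [Fintype σ]
    (A : Subalgebra K (MvPolynomial σ K)) {r : ℕ} (hA : Algebra.trdeg K A ≤ r) (N : ℕ)
    (U : Submodule K (MvPolynomial σ K)) (hUA : U ≤ Subalgebra.toSubmodule A)
    (hU : U ≤ restrictTotalDegree σ K N) [FiniteDimensional K U] :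
    Module.finrank K U ≤ (N + r).choose r := by
  classical
  obtain ⟨I, hI, hcard⟩ := exists_algebraicIndependent_X_card_compl_le A hA
  let v := Module.finBasis K U
  have hv : LinearIndependent K (fun i => (v i : MvPolynomial σ K)) :=
    v.linearIndependent.map' U.subtype U.ker_subtype
  have hv' := linearIndependent_supported_of_algebraicIndependent A hI
    (fun i => hUA (v i).2) hv
  set S := (fun a : (Iᶜ : Set σ) →₀ ℕ => (monomial (a.mapDomain (↑)) 1 : MvPolynomial σ K)) ''
        {a | a.degree ≤ N} with hS
  have hmem : ∀ i, (v i : MvPolynomial σ K) ∈ Submodule.span (supported K I) S := fun i =>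
    restrictTotalDegree_le_span_supported I N (hU (v i).2)
  have hspan : LinearIndependent (supported K I)
      (fun i => (⟨v i, hmem i⟩ : Submodule.span (supported K I) S)) :=
    LinearIndependent.of_comp (Submodule.subtype _) hv'
  have hfin : {a : (Iᶜ : Set σ) →₀ ℕ | a.degree ≤ N}.Finite := Finsupp.finite_of_degree_le N
  have hSfin : S.Finite := hfin.image _
  have := hSfin.to_subtype
  have hle := (hspan.cardinal_lift_le_rank).trans
    (Cardinal.lift_le.mpr (rank_span_le (R := supported K I) S))
  rw [← Nat.cast_card (α := S), Cardinal.mk_fin, Cardinal.lift_natCast, Cardinal.lift_natCast,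
    Nat.cast_le, Nat.card_coe_set_eq] at hle
  have hchoose := ncard_degree_le (Iᶜ : Set σ) N
  rw [← Nat.card_eq_fintype_card] at hchoose
  refine (hle.trans (Set.ncard_image_le hfin)).trans (hchoose.le.trans ?_)
  rw [Nat.choose_symm_add.symm, Nat.choose_symm_add.symm]
  exact Nat.choose_le_choose _ (by omega)

theorem coeff_aeval_monomial_weight {K σ : Type*} [Field K] [Fintype σ] (w : σ → ℕ)
    (p : MvPolynomial σ K) (j : ℕ) (m : σ →₀ ℕ) :
    ((aeval (fun k => Polynomial.monomial (w k) (X k : MvPolynomial σ K)) p).coeff j).coeff m =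
      if Finsupp.weight w m = j then p.coeff m else 0 := by
  classical
  induction p using MvPolynomial.induction_on' with
  | add p q hp hq =>
    simp only [map_add, Polynomial.coeff_add, coeff_add, hp, hq]
    split_ifs <;> simp
  | monomial a c =>
    have : aeval (fun k => Polynomial.monomial (w k) (X k : MvPolynomial σ K)) (monomial a c) =
        Polynomial.monomial (Finsupp.weight w a) (monomial a c) := by
      have hprod : ∏ k, Polynomial.monomial (w k * a k) (X k ^ a k : MvPolynomial σ K) =
          Polynomial.monomial (∑ k, w k * a k) (∏ k, X k ^ a k) := by
        simp only [← Polynomial.C_mul_X_pow_eq_monomial, Finset.prod_mul_distrib,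
          Finset.prod_pow_eq_pow_sum, map_prod]
      have hC : algebraMap K (Polynomial (MvPolynomial σ K)) c = Polynomial.C (C c) := rfl
      rw [aeval_monomial, Finsupp.prod_fintype _ _ (by simp), Finsupp.weight_eq_sum,
        monomial_eq, Finsupp.prod_fintype _ _ (by simp)]
      simp only [Polynomial.monomial_pow, smul_eq_mul]
      rw [hprod, hC, Polynomial.C_mul_monomial]
      simp only [mul_comm]
    rw [this, Polynomial.coeff_monomial]
    split_ifs with h1 h2 h2
    · rfl
    · rw [coeff_monomial, if_neg]
      rintro rfl; exact h2 h1
    · rw [coeff_zero, coeff_monomial, if_neg]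
      rintro rfl; exact h1 h2
    · rfl

theorem natDegree_aeval_monomial_weight_le_iff {K σ : Type*} [Field K] [Fintype σ] (w : σ → ℕ)
    (p : MvPolynomial σ K) (N : ℕ) :
    (aeval (fun k => Polynomial.monomial (w k) (X k : MvPolynomial σ K)) p).natDegree ≤ N ↔
      ∀ m ∈ p.support, Finsupp.weight w m ≤ N := by
  rw [Polynomial.natDegree_le_iff_coeff_eq_zero]
  constructor
  · intro h m hm
    by_contra! hlt
    have := coeff_aeval_monomial_weight w p (Finsupp.weight w m) m
    rw [h _ hlt, if_pos rfl] at this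
    exact (mem_support_iff.mp hm) this.symm
  · intro h j hj
    ext m
    rw [coeff_aeval_monomial_weight, coeff_zero]
    split_ifs with hm
    · by_contra hc
      have := h m (mem_support_iff.mpr hc)
      omega
    · rfl

theorem weight_add_weight_le_of_mul {K σ : Type*} [Field K] [Fintype σ] (w : σ → ℕ)
    {p q : MvPolynomial σ K} {N : ℕ} (hN : ∀ m ∈ (p * q).support, Finsupp.weight w m ≤ N)
    {a b : σ →₀ ℕ} (ha : a ∈ p.support) (hb : b ∈ q.support) :
    Finsupp.weight w a + Finsupp.weight w b ≤ N := by
  have hne : ∀ r : MvPolynomial σ K, r ≠ 0 →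
      aeval (fun k => Polynomial.monomial (w k) (X k : MvPolynomial σ K)) r ≠ 0 := by
    intro r hr h
    obtain ⟨m, hm⟩ := ne_zero_iff.mp hr
    have := coeff_aeval_monomial_weight w r (Finsupp.weight w m) m
    rw [h, if_pos rfl] at this
    exact hm (by simpa using this.symm)
  have hp : p ≠ 0 := by rintro rfl; simp at ha
  have hq : q ≠ 0 := by rintro rfl; simp at hb
  rw [← natDegree_aeval_monomial_weight_le_iff, map_mul,
    Polynomial.natDegree_mul (hne p hp) (hne q hq)] at hN
  exact (add_le_add ((natDegree_aeval_monomial_weight_le_iff w p _).mp le_rfl a ha)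
    ((natDegree_aeval_monomial_weight_le_iff w q _).mp le_rfl b hb)).trans hN

theorem totalDegree_aeval_le_of_weight_le {K σ τ : Type*} [Field K] [Fintype τ] (w : τ → ℕ)
    (F : τ → MvPolynomial σ K) (hF : ∀ k, (F k).totalDegree ≤ w k) {N : ℕ}
    {p : MvPolynomial τ K} (hp : ∀ m ∈ p.support, Finsupp.weight w m ≤ N) :
    (aeval F p).totalDegree ≤ N := by
  rw [aeval_def, eval₂_eq']
  refine totalDegree_finsetSum_le fun m hm => ?_
  refine (totalDegree_mul _ _).trans ?_
  rw [algebraMap_eq, totalDegree_C, zero_add]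
  refine ((totalDegree_finsetProd _ _).trans ?_).trans (hp m hm)
  rw [Finsupp.weight_eq_sum]
  exact Finset.sum_le_sum fun k _ => (totalDegree_pow _ _).trans (Nat.mul_le_mul_left _ (hF k))

theorem ncard_weight_le_add {K σ τ : Type*} [Field K] [Fintype σ] [Fintype τ] (w : τ → ℕ)
    (hw : ∀ k, w k ≠ 0) (F : τ → MvPolynomial σ K) (hF : ∀ k, (F k).totalDegree ≤ w k)
    {P : MvPolynomial τ K}
    (hker : RingHom.ker (aeval F : MvPolynomial τ K →ₐ[K] MvPolynomial σ K) = Ideal.span {P})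
    {m : τ →₀ ℕ} (hm : m ∈ P.support) {r : ℕ}
    (hr : Algebra.trdeg K (Algebra.adjoin K (Set.range F)) ≤ r) (N : ℕ) :
    {a : τ →₀ ℕ | Finsupp.weight w a ≤ N + Finsupp.weight w m}.ncard ≤
      {a : τ →₀ ℕ | Finsupp.weight w a ≤ N}.ncard + (N + Finsupp.weight w m + r).choose r := by
  let V : ℕ → Submodule K (MvPolynomial τ K) := fun N =>
    restrictSupport K {a | Finsupp.weight w a ≤ N}
  have hfin : ∀ N, FiniteDimensional K (V N) := fun N =>
    have := (Finsupp.finite_of_nat_weight_le w hw N).to_subtype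
    Module.Finite.of_basis (basisRestrictSupport K _)
  have hrank : ∀ N, Module.finrank K (V N) = {a : τ →₀ ℕ | Finsupp.weight w a ≤ N}.ncard :=
    fun N => Module.finrank_eq_nat_card_basis (basisRestrictSupport K _)
  set φ := (aeval F : MvPolynomial τ K →ₐ[K] MvPolynomial σ K).toLinearMap with hφ
  set M := N + Finsupp.weight w m
  have hdim := (φ.domRestrict (V M)).finrank_range_add_finrank_ker
  have hrange : Module.finrank K (φ.domRestrict (V M)).range ≤ (M + r).choose r := by
    refine finrank_le_choose_of_trdeg_le _ hr M _ ?_ ?_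
    · rintro _ ⟨x, rfl⟩
      rw [Algebra.adjoin_range_eq_range_aeval]
      exact ⟨x, rfl⟩
    · rintro _ ⟨x, rfl⟩
      rw [mem_restrictTotalDegree]
      exact totalDegree_aeval_le_of_weight_le w F hF x.2
  have hkerle : Module.finrank K (φ.domRestrict (V M)).ker ≤ Module.finrank K (V N) := by
    have hsub : (φ.domRestrict (V M)).ker.map (V M).subtype ≤
        (V N).map (LinearMap.mulLeft K P) := by
      rintro _ ⟨x, hx, rfl⟩
      have hx' : (x : MvPolynomial τ K) ∈
          RingHom.ker (aeval F : MvPolynomial τ K →ₐ[K] MvPolynomial σ K) := hx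
      rw [hker, Ideal.mem_span_singleton'] at hx'
      obtain ⟨q, hq⟩ := hx'
      refine ⟨q, fun a ha => ?_, by simpa [mul_comm] using hq⟩
      have hxM : ∀ b ∈ (q * P).support, Finsupp.weight w b ≤ M := by
        rw [hq]
        exact fun b hb => x.2 hb
      have := weight_add_weight_le_of_mul w hxM ha hm
      exact Nat.le_of_add_le_add_right this
    rw [← Submodule.finrank_map_subtype_eq]
    exact (Submodule.finrank_mono hsub).trans (Submodule.finrank_map_le _ _)
  rw [← hrank, ← hrank, ← hdim]
  omega

theorem totalDegree_derivation_le {K σ : Type*} [Field K] [CharZero K]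
    (L : Derivation ℚ (MvPolynomial σ K) (MvPolynomial σ K)) {D : ℕ} (hD : 1 ≤ D)
    (hLX : ∀ i, (L (X i)).totalDegree ≤ D) (hLC : ∀ c : K, ∃ c' : K, L (C c) = C c')
    (p : MvPolynomial σ K) : (L p).totalDegree ≤ p.totalDegree + (D - 1) := by
  classical
  have hmon : ∀ (a : σ →₀ ℕ) (c : K), (L (monomial a c)).totalDegree ≤ a.degree + (D - 1) := by
    have hadd : ∀ a b : σ →₀ ℕ,
        (∀ c : K, (L (monomial a c)).totalDegree ≤ a.degree + (D - 1)) →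
        (∀ c : K, (L (monomial b c)).totalDegree ≤ b.degree + (D - 1)) →
        ∀ c : K, (L (monomial (a + b) c)).totalDegree ≤ (a + b).degree + (D - 1) := by
      intro a b ha hb c
      rw [← mul_one c, ← monomial_mul, L.leibniz, smul_eq_mul, smul_eq_mul, map_add]
      have hdeg : ∀ (a : σ →₀ ℕ) (c : K), (monomial a c).totalDegree ≤ a.degree :=
        fun a c => totalDegree_monomial_le a c
      refine (totalDegree_add _ _).trans (max_le ?_ ?_)
      · refine (totalDegree_mul _ _).trans ((add_le_add (hdeg a c) (hb 1)).trans ?_)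
        omega
      · refine (totalDegree_mul _ _).trans ((add_le_add (hdeg b 1) (ha c)).trans ?_)
        omega
    have hzero : ∀ c : K, (L (monomial 0 c)).totalDegree ≤ (0 : σ →₀ ℕ).degree + (D - 1) := by
      intro c
      obtain ⟨c', hc'⟩ := hLC c
      rw [← C_apply, hc', totalDegree_C]
      exact Nat.zero_le _
    have hone : ∀ (i : σ) (c : K),
        (L (monomial (Finsupp.single i 1) c)).totalDegree ≤
          (Finsupp.single i 1).degree + (D - 1) := by
      intro i c
      obtain ⟨c', hc'⟩ := hLC c
      rw [← C_mul_X_eq_monomial, L.leibniz, hc', smul_eq_mul, smul_eq_mul, Finsupp.degree_single]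
      refine (totalDegree_add _ _).trans (max_le ?_ ?_)
      · refine (totalDegree_mul _ _).trans ?_
        have := hLX i
        rw [totalDegree_C]
        omega
      · refine (totalDegree_mul _ _).trans ?_
        rw [totalDegree_C, totalDegree_X]
        omega
    intro a
    induction a using Finsupp.induction_linear with
    | zero => exact hzero
    | add a b ha hb => exact hadd a b ha hb
    | single i n =>
      induction n with
      | zero => simpa using hzero
      | succ n ih =>
        rw [Finsupp.single_add]
        exact hadd _ _ ih (hone i)
  conv_lhs => rw [p.as_sum, map_sum]
  refine totalDegree_finsetSum_le fun m hm => (hmon m _).trans ?_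
  exact Nat.add_le_add_right (le_totalDegree hm) _

theorem stmt3 {K : Type*} [Field K] [CharZero K] {n : ℕ} (hn : 1 ≤ n)
    (g : Fin n → MvPolynomial (Fin n) K) (f : MvPolynomial (Fin n) K)
    (L : Derivation ℚ (MvPolynomial (Fin n) K) (MvPolynomial (Fin n) K))
    (hLx : ∀ i, L (X i) = g i)
    (hLC : ∀ c : K, ∃ c' : K, L (C c) = C c')
    (d D : ℕ)
    (hd : d = f.totalDegree)
    (hD : D = Finset.univ.sup fun i => (g i).totalDegree)
    (hd1 : 1 ≤ d) (hD1 : 1 ≤ D)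
    (ν : ℕ)
    (hinj : ∀ ν' < ν, RingHom.ker (liePhiNP f L ν') = ⊥)
    (P : MvPolynomial (Fin (ν + 1)) K) (hP0 : P ≠ 0)
    (hPgen : RingHom.ker (liePhiNP f L ν) = Ideal.span {P}) :
    ∀ m ∈ P.support,
      (∑ k : Fin (ν + 1), (d + (k : ℕ) * (D - 1)) * m k) ≤
        ∏ k : Fin (ν + 1), (d + (k : ℕ) * (D - 1)) := by
  have hF : ∀ k : ℕ, ((⇑L)^[k] f).totalDegree ≤ d + k * (D - 1) := by
    intro k
    induction k with
    | zero => simp [hd]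
    | succ k ih =>
      rw [Function.iterate_succ_apply', Nat.succ_mul, ← add_assoc]
      refine (totalDegree_derivation_le L hD1 (fun i => ?_) hLC _).trans
        (Nat.add_le_add_right ih _)
      rw [hLx, hD]
      exact Finset.le_sup (f := fun i => (g i).totalDegree) (Finset.mem_univ i)
  intro m hm
  let w : Fin (ν + 1) → ℕ := fun k => d + (k : ℕ) * (D - 1)
  have hw : ∀ k, w k ≠ 0 := fun k => by simp only [w]; omega
  have hindep : ¬ AlgebraicIndependent K (fun k : Fin (ν + 1) => (⇑L)^[(k : ℕ)] f) := by
    intro h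
    have hP : P ∈ RingHom.ker (liePhiNP f L ν) := by
      rw [hPgen]
      exact Ideal.mem_span_singleton_self P
    exact hP0 (h (((RingHom.mem_ker).mp hP).trans (map_zero _).symm))
  have hweight : ∑ k : Fin (ν + 1), (d + (k : ℕ) * (D - 1)) * m k = Finsupp.weight w m := by
    rw [Finsupp.weight_eq_sum]
    exact Finset.sum_congr rfl fun k _ => mul_comm _ _
  rw [hweight]
  rcases Nat.eq_zero_or_pos (Finsupp.weight w m) with h0 | hpos
  · rw [h0]
    exact Nat.zero_le _
  · exact le_prod_of_ncard_weight_growth w hw hpos fun N =>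
      ncard_weight_le_add w hw _ (fun k => hF k) hPgen hm
        (trdeg_adjoin_range_le_of_not_algebraicIndependent _ hindep) N
end
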